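/- arXiv:2006.07600 — 4 statements merged into one kernel-verified Lean document; each statement's English description precedes it below -/
import Mathlib

section
/- Let f, g ∈ ℂ[z] and suppose the monodromy group G of the deformation f + εg is two-transitive. Let C be a zero cycle of f. Then the deformation f + εg has an infinitesimal center for C (i.e. Δ(t,ε) ≡ 0 for all regular t and all small ε) if and only if f, g and C satisfy the composition condition. -/
open Polynomial OnePoint

noncomputable section

/-- The degree `n` in `z` of the deformation `f + ε g`. -/
def defDeg (f g : Polynomial ℂ) : ℕ := max f.natDegree g.natDegree

/-- `c(ε)`: the leading coefficient of `f + ε g` as a polynomial in `z`. -/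
def leadC (f g : Polynomial ℂ) (ε : ℂ) : ℂ :=
  f.coeff (defDeg f g) + ε * g.coeff (defDeg f g)

/-- The finite part of `Σ`: the set of `(t, ε) ∈ ℂ²` with `c(ε) D(t,ε) = 0`,
`D` being the discriminant of `f + ε g - t` in `z`; equivalently, `c(ε) = 0` or
`f + ε g - t` has a multiple root. -/
def sigmaFin (f g : Polynomial ℂ) : Set (ℂ × ℂ) :=
  {p | leadC f g p.2 = 0 ∨ ∃ w : ℂ,
    f.eval w + p.2 * g.eval w = p.1 ∧
    f.derivative.eval w + p.2 * g.derivative.eval w = 0}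

/-- `Σ = {(t,ε) : c(ε)D(t,ε) = 0} ∪ {∞} × ℂ ⊆ ℂP¹ × ℂ`. -/
def sigmaSet (f g : Polynomial ℂ) : Set (OnePoint ℂ × ℂ) :=
  {p | p.1 = ∞ ∨ ∃ t : ℂ, p.1 = (t : OnePoint ℂ) ∧ (t, p.2) ∈ sigmaFin f g}

/-- The fiber of `H(z,ε) = (f(z) + ε g(z), ε)` over `(t₀, ε₀)`. -/
abbrev theFiber (f g : Polynomial ℂ) (t₀ ε₀ : ℂ) : Type :=
  {w : ℂ // f.eval w + ε₀ * g.eval w = t₀}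

/-- A permutation of the fiber over `(t₀,ε₀)` is a monodromy permutation if it is
realized by lifting some closed path in `(ℂP¹ × ℂ) \ Σ` based at `(t₀,ε₀)`. -/
def IsMonodromyPerm (f g : Polynomial ℂ) (t₀ ε₀ : ℂ)
    (σ : Equiv.Perm (theFiber f g t₀ ε₀)) : Prop :=
  ∃ γ : ℝ → OnePoint ℂ × ℂ,
    ContinuousOn γ (Set.Icc 0 1) ∧ γ 0 = ((t₀ : OnePoint ℂ), ε₀) ∧
    γ 1 = ((t₀ : OnePoint ℂ), ε₀) ∧ (∀ s ∈ Set.Icc (0 : ℝ) 1, γ s ∉ sigmaSet f g) ∧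
    ∀ x : theFiber f g t₀ ε₀, ∃ l : ℝ → ℂ,
      ContinuousOn l (Set.Icc 0 1) ∧ l 0 = x.1 ∧ l 1 = (σ x).1 ∧
      ∀ s ∈ Set.Icc (0 : ℝ) 1,
        ((f.eval (l s) + (γ s).2 * g.eval (l s) : ℂ) : OnePoint ℂ) = (γ s).1

/-- The monodromy group `G` of the deformation `f + ε g`: the subgroup of the
symmetric group of the fiber generated by all monodromy permutations. -/
def MonodromyGroup (f g : Polynomial ℂ) (t₀ ε₀ : ℂ) :
    Subgroup (Equiv.Perm (theFiber f g t₀ ε₀)) :=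
  Subgroup.closure {σ | IsMonodromyPerm f g t₀ ε₀ σ}

/-- The set of critical values of a polynomial `P`. -/
def polyCrit (P : Polynomial ℂ) : Set ℂ :=
  {t | ∃ w : ℂ, P.eval w = t ∧ P.derivative.eval w = 0}

/-- The fiber `P⁻¹(t)` of a polynomial `P`. -/
abbrev polyFiber (P : Polynomial ℂ) (t : ℂ) : Type := {w : ℂ // P.eval w = t}

/-- Monodromy permutations of a single polynomial `P`: permutations of the fiber
`P⁻¹(t₁)` realized by lifting closed paths in `ℂ \ {critical values}`. -/
def IsPolyMonodromyPerm (P : Polynomial ℂ) (t₁ : ℂ)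
    (σ : Equiv.Perm (polyFiber P t₁)) : Prop :=
  ∃ γ : ℝ → ℂ, ContinuousOn γ (Set.Icc 0 1) ∧ γ 0 = t₁ ∧ γ 1 = t₁ ∧
    (∀ s ∈ Set.Icc (0 : ℝ) 1, γ s ∉ polyCrit P) ∧
    ∀ x : polyFiber P t₁, ∃ l : ℝ → ℂ, ContinuousOn l (Set.Icc 0 1) ∧
      l 0 = x.1 ∧ l 1 = (σ x).1 ∧ ∀ s ∈ Set.Icc (0 : ℝ) 1, P.eval (l s) = γ s

/-- The monodromy group of a single polynomial `P`, based at `t₁`. -/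
def PolyMonodromyGroup (P : Polynomial ℂ) (t₁ : ℂ) :
    Subgroup (Equiv.Perm (polyFiber P t₁)) :=
  Subgroup.closure {σ | IsPolyMonodromyPerm P t₁ σ}

/-- The group homomorphism `Perm X →* Perm Y` induced by a bijection `e : X ≃ Y`. -/
def permMapHom {X Y : Type*} (e : X ≃ Y) : Equiv.Perm X →* Equiv.Perm Y where
  toFun σ := (e.symm.trans σ).trans e
  map_one' := by ext y; simp
  map_mul' σ τ := by ext y; simp [Equiv.Perm.mul_apply]

/-- Two permutation groups are permutationally isomorphic if some bijection of the
underlying sets conjugates one onto the other. -/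
def PermIsoOn {X Y : Type*} (G : Subgroup (Equiv.Perm X))
    (H : Subgroup (Equiv.Perm Y)) : Prop :=
  ∃ e : X ≃ Y, G.map (permMapHom e) = H

/-- A permutation group `G ≤ Perm X` is two-transitive if it acts transitively on
ordered pairs of distinct points. -/
def IsTwoTransitive {X : Type*} (G : Subgroup (Equiv.Perm X)) : Prop :=
  ∀ x₁ x₂ y₁ y₂ : X, x₁ ≠ x₂ → y₁ ≠ y₂ → ∃ σ ∈ G, σ x₁ = y₁ ∧ σ x₂ = y₂

/-- A permutation group `G ≤ Perm X` is imprimitive if there is a proper subset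
`B ⊆ X` with more than one element such that every `σ ∈ G` satisfies
`σ(B) ∩ B = ∅` or `σ(B) = B`. -/
def IsImprimitive {X : Type*} (G : Subgroup (Equiv.Perm X)) : Prop :=
  ∃ B : Set X, (∃ x ∈ B, ∃ y ∈ B, x ≠ y) ∧ B ≠ Set.univ ∧
    ∀ σ ∈ G, ((fun x => σ x) '' B) ∩ B = ∅ ∨ (fun x => σ x) '' B = B

/-- The member `f + ε g` of the deformation. -/
def deformation (f g : Polynomial ℂ) (ε : ℂ) : Polynomial ℂ := f + C ε * g

lemma eval_deformation (f g : Polynomial ℂ) (ε w : ℂ) :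
    (deformation f g ε).eval w = f.eval w + ε * g.eval w := by
  simp [deformation]

lemma eval_derivative_deformation (f g : Polynomial ℂ) (ε w : ℂ) :
    (deformation f g ε).derivative.eval w = f.derivative.eval w + ε * g.derivative.eval w := by
  simp [deformation]

lemma coeff_deformation_defDeg (f g : Polynomial ℂ) (ε : ℂ) :
    (deformation f g ε).coeff (defDeg f g) = leadC f g ε := by
  simp [deformation, leadC]

lemma natDegree_deformation_le (f g : Polynomial ℂ) (ε : ℂ) :
    (deformation f g ε).natDegree ≤ defDeg f g :=
  (natDegree_add_le _ _).trans (max_le_max le_rfl (natDegree_C_mul_le _ _))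

lemma natDegree_deformation {f g : Polynomial ℂ} {ε : ℂ} (h : leadC f g ε ≠ 0) :
    (deformation f g ε).natDegree = defDeg f g :=
  natDegree_eq_of_le_of_coeff_ne_zero (natDegree_deformation_le f g ε)
    (by rwa [coeff_deformation_defDeg])

lemma natDegree_deformation_sub {f g : Polynomial ℂ} {ε : ℂ} (h : leadC f g ε ≠ 0) (t : ℂ) :
    (deformation f g ε - C t).natDegree = defDeg f g := by
  rw [natDegree_sub_C, natDegree_deformation h]

lemma deformation_sub_ne_zero {f g : Polynomial ℂ} {ε : ℂ} (hn : 0 < defDeg f g)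
    (h : leadC f g ε ≠ 0) (t : ℂ) : deformation f g ε - C t ≠ 0 := by
  intro h0
  have := natDegree_deformation_sub h t
  rw [h0, natDegree_zero] at this
  omega

lemma mem_roots_deformation_sub {f g : Polynomial ℂ} {ε : ℂ} (hn : 0 < defDeg f g)
    (h : leadC f g ε ≠ 0) (t w : ℂ) :
    w ∈ (deformation f g ε - C t).roots ↔ f.eval w + ε * g.eval w = t := by
  rw [mem_roots (deformation_sub_ne_zero hn h t), IsRoot, eval_sub, eval_C, eval_deformation,
    sub_eq_zero]

/-- Off the ramification locus, the fiber has exactly `defDeg f g` points. -/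
lemma exists_enumeration_fiber {f g : Polynomial ℂ} (hn : 0 < defDeg f g) {p : ℂ × ℂ}
    (hp : p ∉ sigmaFin f g) :
    ∃ x : Fin (defDeg f g) → ℂ, Function.Injective x ∧
      ∀ k, f.eval (x k) + p.2 * g.eval (x k) = p.1 := by
  simp only [sigmaFin, Set.mem_ofPred_eq, not_or, not_exists, not_and] at hp
  obtain ⟨hc, hsimple⟩ := hp
  set P := deformation f g p.2 - C p.1 with hP
  have hP0 : P ≠ 0 := deformation_sub_ne_zero hn hc p.1
  have hnodup : P.roots.Nodup := by
    rw [Multiset.nodup_iff_count_le_one]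
    intro w
    rw [count_roots]
    by_contra! hlt
    rw [one_lt_rootMultiplicity_iff_isRoot hP0] at hlt
    refine hsimple w ?_ ?_
    · have := hlt.1
      rwa [← mem_roots_deformation_sub hn hc, mem_roots hP0]
    · have := hlt.2
      rwa [hP, IsRoot, derivative_sub, derivative_C, sub_zero, eval_derivative_deformation] at this
  have hcard : P.roots.toFinset.card = defDeg f g := by
    rw [Multiset.toFinset_card_of_nodup hnodup, ← (IsAlgClosed.splits P).natDegree_eq_card_roots,
      natDegree_deformation_sub hc]
  refine ⟨fun k => ((Finset.equivFinOfCardEq hcard).symm k : ℂ),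
    fun i j hij => (Finset.equivFinOfCardEq hcard).symm.injective (Subtype.ext hij), fun k => ?_⟩
  have := ((Finset.equivFinOfCardEq hcard).symm k).2
  rwa [Multiset.mem_toFinset, mem_roots_deformation_sub hn hc] at this

lemma roots_deformation_sub_eq {f g : Polynomial ℂ} (hn : 0 < defDeg f g) {p : ℂ × ℂ}
    (hc : leadC f g p.2 ≠ 0) {y : Fin (defDeg f g) → ℂ} (hy : Function.Injective y)
    (hroot : ∀ k, f.eval (y k) + p.2 * g.eval (y k) = p.1) :
    (deformation f g p.2 - C p.1).roots = Finset.univ.val.map y := by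
  symm
  refine Multiset.eq_of_le_of_card_le ?_ ?_
  · rw [Multiset.le_iff_subset (Finset.univ.nodup.map hy)]
    intro w hw
    obtain ⟨k, -, rfl⟩ := Multiset.mem_map.1 hw
    exact (mem_roots_deformation_sub hn hc _ _).2 (hroot k)
  · refine (card_roots' _).trans ?_
    rw [natDegree_deformation_sub hc]
    simp

/-- `defDeg f g` distinct points exhaust a fiber. -/
lemma exists_eq_of_injective_of_roots {f g : Polynomial ℂ} (hn : 0 < defDeg f g) {p : ℂ × ℂ}
    (hc : leadC f g p.2 ≠ 0) {y : Fin (defDeg f g) → ℂ} (hy : Function.Injective y)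
    (hroot : ∀ k, f.eval (y k) + p.2 * g.eval (y k) = p.1) {w : ℂ}
    (hw : f.eval w + p.2 * g.eval w = p.1) : ∃ k, w = y k := by
  rw [← mem_roots_deformation_sub hn hc, roots_deformation_sub_eq hn hc hy hroot] at hw
  obtain ⟨k, -, rfl⟩ := Multiset.mem_map.1 hw
  exact ⟨k, rfl⟩

lemma notMem_sigmaFin_of_injective_of_roots {f g : Polynomial ℂ} (hn : 0 < defDeg f g) {p : ℂ × ℂ}
    (hc : leadC f g p.2 ≠ 0) {y : Fin (defDeg f g) → ℂ} (hy : Function.Injective y)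
    (hroot : ∀ k, f.eval (y k) + p.2 * g.eval (y k) = p.1) : p ∉ sigmaFin f g := by
  rintro (h | ⟨w, hw, hw'⟩)
  · exact hc h
  have hP0 := deformation_sub_ne_zero hn hc p.1
  have h1 : 1 < (deformation f g p.2 - C p.1).rootMultiplicity w := by
    rw [one_lt_rootMultiplicity_iff_isRoot hP0]
    refine ⟨?_, ?_⟩
    · rwa [← mem_roots hP0, mem_roots_deformation_sub hn hc]
    · rwa [IsRoot, derivative_sub, derivative_C, sub_zero, eval_derivative_deformation]
  have hnodup : (deformation f g p.2 - C p.1).roots.Nodup := by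
    rw [roots_deformation_sub_eq hn hc hy hroot]
    exact Finset.univ.nodup.map hy
  rw [← count_roots] at h1
  exact h1.not_ge (Multiset.nodup_iff_count_le_one.1 hnodup w)

open scoped Topology ContDiff in
/-- A simple root of `f + ε g - t` extends to a local analytic branch. -/
lemma exists_analyticAt_branch {f g : Polynomial ℂ} {p : ℂ × ℂ} {w : ℂ}
    (hw : f.eval w + p.2 * g.eval w = p.1)
    (hw' : f.derivative.eval w + p.2 * g.derivative.eval w ≠ 0) :
    ∃ φ : ℂ × ℂ → ℂ, AnalyticAt ℂ φ p ∧ φ p = w ∧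
      ∀ᶠ q in 𝓝 p, f.eval (φ q) + q.2 * g.eval (φ q) = q.1 := by
  set F : (ℂ × ℂ) × ℂ → ℂ := fun u => f.eval u.2 + u.1.2 * g.eval u.2 - u.1.1 with hF
  have han : AnalyticAt ℂ F (p, w) := by
    have hev (P : Polynomial ℂ) : AnalyticAt ℂ (fun u : (ℂ × ℂ) × ℂ => P.eval u.2) (p, w) := by
      simpa using AnalyticAt.aeval_polynomial (A := ℂ) (B := ℂ)
        (f := fun u : (ℂ × ℂ) × ℂ => u.2) analyticAt_snd P
    exact ((hev f).add ((analyticAt_snd.comp analyticAt_fst).mul (hev g))).sub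
      (analyticAt_fst.comp analyticAt_fst)
  have hcd : ContDiffAt ℂ ω F (p, w) := han.contDiffAt
  have hderiv : HasDerivAt (fun y => F (p, y))
      (f.derivative.eval w + p.2 * g.derivative.eval w) w :=
    ((f.hasDerivAt w).add ((g.hasDerivAt w).const_mul p.2)).sub_const p.1
  have hone : (fderiv ℂ F (p, w) ∘L .inr ℂ (ℂ × ℂ) ℂ) 1 =
      f.derivative.eval w + p.2 * g.derivative.eval w := by
    have h1 := (han.differentiableAt.hasFDerivAt.comp w
      (hasFDerivAt_prodMk_right p w)).hasDerivAt
    exact h1.unique hderiv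
  have hinv : (fderiv ℂ F (p, w) ∘L .inr ℂ (ℂ × ℂ) ℂ).IsInvertible := by
    refine ⟨ContinuousLinearEquiv.unitsEquivAut ℂ (Units.mk0 _ hw'), ?_⟩
    ext
    rw [hone]
    simp
  have hω : (ω : WithTop ℕ∞) ≠ 0 := by simp
  refine ⟨hcd.implicitFunction hω hinv, ?_, hcd.implicitFunction_apply_self hω hinv, ?_⟩
  · exact (hcd.contDiffAt_implicitFunction hω hinv).analyticAt
  · filter_upwards [hcd.eventually_apply_implicitFunction hω hinv] with q hq
    have h0 : F (p, w) = 0 := by simp [hF, hw]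
    rw [h0] at hq
    exact sub_eq_zero.1 hq

/-- `φ` enumerates the roots of `f + ε g = t` by analytic branches on the connected open set `B`. -/
structure IsBranchSystem (f g : Polynomial ℂ) (B : Set (ℂ × ℂ))
    (φ : Fin (defDeg f g) → ℂ × ℂ → ℂ) : Prop where
  isOpen : IsOpen B
  isPreconnected : IsPreconnected B
  disjoint : ∀ q ∈ B, q ∉ sigmaFin f g
  analytic : ∀ k, AnalyticOnNhd ℂ (φ k) B
  injective : ∀ q ∈ B, Function.Injective fun k => φ k q
  root : ∀ q ∈ B, ∀ k, f.eval (φ k q) + q.2 * g.eval (φ k q) = q.1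
  complete : ∀ q ∈ B, ∀ w, f.eval w + q.2 * g.eval w = q.1 → ∃ k, w = φ k q

lemma continuous_leadC (f g : Polynomial ℂ) : Continuous (leadC f g) := by
  unfold leadC
  fun_prop

open scoped Topology in
/-- Every point off the ramification locus has a neighborhood carrying a branch system. -/
lemma exists_isBranchSystem {f g : Polynomial ℂ} (hn : 0 < defDeg f g) {p : ℂ × ℂ}
    (hp : p ∉ sigmaFin f g) : ∃ B φ, p ∈ B ∧ IsBranchSystem f g B φ := by
  obtain ⟨x, hx, hroot⟩ := exists_enumeration_fiber hn hp
  have hp' := hp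
  simp only [sigmaFin, Set.mem_ofPred_eq, not_or, not_exists, not_and] at hp'
  obtain ⟨hc, hsimple⟩ := hp'
  choose φ hφan hφp hφroot using fun k => exists_analyticAt_branch (hroot k)
    (hsimple (x k) (hroot k))
  have hlead : ∀ᶠ q : ℂ × ℂ in 𝓝 p, leadC f g q.2 ≠ 0 :=
    ((continuous_leadC f g).comp continuous_snd).continuousAt.eventually_ne hc
  have hinj : ∀ᶠ q in 𝓝 p, ∀ i j, i ≠ j → φ i q ≠ φ j q := by
    simp only [Filter.eventually_all]
    intro i j hij
    refine (((hφan i).sub (hφan j)).continuousAt.eventually_ne ?_).mono fun q => sub_ne_zero.1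
    rw [Pi.sub_apply, hφp, hφp]
    exact sub_ne_zero.2 (hx.ne hij)
  have hev := hlead.and (hinj.and ((Filter.eventually_all.2 hφroot).and
    (Filter.eventually_all.2 fun k => (hφan k).eventually_analyticAt)))
  obtain ⟨ρ, hρ, hball⟩ := Metric.eventually_nhds_iff_ball.1 hev
  have hinj' : ∀ q ∈ Metric.ball p ρ, Function.Injective fun k => φ k q := fun q hq i j hij => by
    by_contra hne
    exact (hball q hq).2.1 i j hne hij
  refine ⟨Metric.ball p ρ, φ, Metric.mem_ball_self hρ, Metric.isOpen_ball,
    (convex_ball p ρ).isPreconnected, fun q hq => ?_, fun k q hq => (hball q hq).2.2.2 k,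
    hinj', fun q hq => (hball q hq).2.2.1, fun q hq w hw => ?_⟩
  · exact notMem_sigmaFin_of_injective_of_roots hn (hball q hq).1 (hinj' q hq) (hball q hq).2.2.1
  · exact exists_eq_of_injective_of_roots hn (hball q hq).1 (hinj' q hq) (hball q hq).2.2.1 hw

open scoped Topology in
/-- A continuous family of roots follows a single branch locally. -/
lemma IsBranchSystem.eventually_eq {f g : Polynomial ℂ} {B : Set (ℂ × ℂ)}
    {φ : Fin (defDeg f g) → ℂ × ℂ → ℂ} (h : IsBranchSystem f g B φ) {q : ℂ × ℂ} (hq : q ∈ B)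
    {Y : Type*} {F : Filter Y} {γ : Y → ℂ × ℂ} {l : Y → ℂ} {k : Fin (defDeg f g)}
    (hγ : Filter.Tendsto γ F (𝓝 q)) (hl : Filter.Tendsto l F (𝓝 (φ k q)))
    (hroot : ∀ᶠ y in F, f.eval (l y) + (γ y).2 * g.eval (l y) = (γ y).1) :
    ∀ᶠ y in F, l y = φ k (γ y) := by
  have hne : ∀ᶠ y in F, ∀ j, j ≠ k → l y ≠ φ j (γ y) := by
    simp only [Filter.eventually_all]
    intro j hj
    have hj' : Filter.Tendsto (fun y => φ j (γ y)) F (𝓝 (φ j q)) :=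
      (h.analytic j q hq).continuousAt.tendsto.comp hγ
    exact ((hl.sub hj').eventually_ne (sub_ne_zero.2 ((h.injective q hq).ne hj.symm))).mono
      fun y => sub_ne_zero.1
  filter_upwards [hne, hroot, hγ (h.isOpen.mem_nhds hq)] with y h1 h2 h3
  obtain ⟨j, hj⟩ := h.complete _ h3 _ h2
  by_cases hjk : j = k
  · rw [hj, hjk]
  · exact absurd hj (h1 j hjk)

open scoped Topology in
/-- The relation `∑ c i * f (y i) = 0` holds for all roots `y i` of `f + ε g = t` close to `x i`
whenever `(t, ε)` is close to `p`. -/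
def GermRelation (f g : Polynomial ℂ) {m : ℕ} (c : Fin m → ℂ) (p : ℂ × ℂ) (x : Fin m → ℂ) : Prop :=
  ∀ᶠ u : (ℂ × ℂ) × (Fin m → ℂ) in 𝓝 (p, x),
    (∀ i, f.eval (u.2 i) + u.1.2 * g.eval (u.2 i) = u.1.1) → ∑ i, c i * f.eval (u.2 i) = 0

/-- The identity theorem for relations between branches. -/
lemma IsBranchSystem.sum_eq_zero {f g : Polynomial ℂ} {B : Set (ℂ × ℂ)}
    {φ : Fin (defDeg f g) → ℂ × ℂ → ℂ} (h : IsBranchSystem f g B φ) {q : ℂ × ℂ} (hq : q ∈ B)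
    {m : ℕ} {c : Fin m → ℂ} {k : Fin m → Fin (defDeg f g)}
    (hev : ∀ᶠ q' in nhds q, ∑ i, c i * f.eval (φ (k i) q') = 0) :
    ∀ q' ∈ B, ∑ i, c i * f.eval (φ (k i) q') = 0 := by
  have han : AnalyticOnNhd ℂ (fun q' => ∑ i, c i * f.eval (φ (k i) q')) B := by
    refine Finset.analyticOnNhd_fun_sum _ fun i _ => analyticOnNhd_const.mul ?_
    simpa using (h.analytic (k i)).aeval_polynomial (B := ℂ) f
  exact han.eqOn_zero_of_preconnected_of_eventuallyEq_zero h.isPreconnected hq hev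

open scoped Topology in
/-- Analytic continuation within the domain of a branch system. -/
lemma IsBranchSystem.germRelation_iff {f g : Polynomial ℂ} {B : Set (ℂ × ℂ)}
    {φ : Fin (defDeg f g) → ℂ × ℂ → ℂ} (h : IsBranchSystem f g B φ) {q : ℂ × ℂ} (hq : q ∈ B)
    {m : ℕ} (c : Fin m → ℂ) (k : Fin m → Fin (defDeg f g)) :
    GermRelation f g c q (fun i => φ (k i) q) ↔
      ∀ q' ∈ B, ∑ i, c i * f.eval (φ (k i) q') = 0 := by
  have hφcont : ContinuousAt (fun q' => (q', fun i => φ (k i) q')) q :=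
    continuousAt_id.prodMk (continuousAt_pi.2 fun i => (h.analytic (k i) q hq).continuousAt)
  constructor
  · intro hrel
    refine h.sum_eq_zero hq ?_
    filter_upwards [hφcont.tendsto.eventually hrel, h.isOpen.mem_nhds hq] with q' h1 h2
    exact h1 fun i => h.root q' h2 (k i)
  · intro hall
    set S : Set ((ℂ × ℂ) × (Fin m → ℂ)) :=
      {u | ∀ i, f.eval (u.2 i) + u.1.2 * g.eval (u.2 i) = u.1.1} with hS
    set F := 𝓝 (q, fun i => φ (k i) q) ⊓ Filter.principal S with hF
    have hfst : Filter.Tendsto Prod.fst F (𝓝 q) :=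
      (continuous_fst.tendsto _).mono_left inf_le_left
    have hsnd (i : Fin m) : Filter.Tendsto (fun u => u.2 i) F (𝓝 (φ (k i) q)) :=
      (((continuous_apply i).comp continuous_snd).tendsto (q, fun i => φ (k i) q)).mono_left
        inf_le_left
    have hSF : ∀ᶠ u in F, u ∈ S := Filter.le_principal_iff.1 inf_le_right
    have hfollow : ∀ᶠ u in F, ∀ i, u.2 i = φ (k i) u.1 :=
      Filter.eventually_all.2 fun i =>
        h.eventually_eq hq hfst (hsnd i) (hSF.mono fun u hu => hu i)
    refine Filter.eventually_inf_principal.1 (?_ : ∀ᶠ u in F, _)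
    filter_upwards [hfollow, hfst.eventually (h.isOpen.mem_nhds hq)] with u h1 h2
    simp only [h1]
    exact hall u.1 h2

/-- A property that is locally constant along a preconnected set is constant on it. -/
lemma IsPreconnected.iff_of_eventually_iff {α : Type*} [TopologicalSpace α] {s : Set α}
    (hs : IsPreconnected s) {Q : α → Prop} (hQ : ∀ x ∈ s, ∀ᶠ y in nhdsWithin x s, Q y ↔ Q x)
    {x y : α} (hx : x ∈ s) (hy : y ∈ s) : Q x ↔ Q y := by
  classical
  have hcont : ContinuousOn (fun x => decide (Q x)) s := by
    intro x hx
    rw [ContinuousWithinAt, nhds_discrete, Filter.tendsto_pure]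
    filter_upwards [hQ x hx] with y hy
    exact decide_eq_decide.2 hy
  exact decide_eq_decide.1 (hs.constant hcont hx hy)

open scoped Topology in
/-- Continuation of a relation along lifts of a path avoiding the ramification locus. -/
lemma germRelation_iff_of_lift {f g : Polynomial ℂ} (hn : 0 < defDeg f g) {m : ℕ} (c : Fin m → ℂ)
    {Y : Type*} [TopologicalSpace Y] {s : Set Y} (hs : IsPreconnected s) {γ : Y → ℂ × ℂ}
    {l : Y → Fin m → ℂ} (hγ : ContinuousOn γ s) (hl : ContinuousOn l s)
    (hunram : ∀ y ∈ s, γ y ∉ sigmaFin f g)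
    (hroot : ∀ y ∈ s, ∀ i, f.eval (l y i) + (γ y).2 * g.eval (l y i) = (γ y).1)
    {y y' : Y} (hy : y ∈ s) (hy' : y' ∈ s) :
    GermRelation f g c (γ y) (l y) ↔ GermRelation f g c (γ y') (l y') := by
  refine hs.iff_of_eventually_iff (Q := fun y => GermRelation f g c (γ y) (l y))
    (fun y hy => ?_) hy hy'
  obtain ⟨B, φ, hB, h⟩ := exists_isBranchSystem hn (hunram y hy)
  choose k hk using fun i => h.complete _ hB (l y i) (hroot y hy i)
  have hfollow : ∀ᶠ y' in 𝓝[s] y, ∀ i, l y' i = φ (k i) (γ y') := by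
    refine Filter.eventually_all.2 fun i => h.eventually_eq hB (hγ y hy) ?_ ?_
    · rw [← hk]
      exact tendsto_pi_nhds.1 (hl y hy) i
    · filter_upwards [self_mem_nhdsWithin] with y' hy' using hroot y' hy' i
  filter_upwards [hfollow, (hγ y hy).eventually (h.isOpen.mem_nhds hB)] with y' h1 h2
  rw [show l y' = fun i => φ (k i) (γ y') from funext h1,
    show l y = fun i => φ (k i) (γ y) from funext hk, h.germRelation_iff h2, h.germRelation_iff hB]

/-- The relation with coefficients `c` holds near `p` for some choice of distinct roots. -/
def HasGermRelation (f g : Polynomial ℂ) {m : ℕ} (c : Fin m → ℂ) (p : ℂ × ℂ) : Prop :=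
  ∃ x : Fin m → ℂ, Function.Injective x ∧
    (∀ i, f.eval (x i) + p.2 * g.eval (x i) = p.1) ∧ GermRelation f g c p x

lemma IsBranchSystem.hasGermRelation_iff {f g : Polynomial ℂ} {B : Set (ℂ × ℂ)}
    {φ : Fin (defDeg f g) → ℂ × ℂ → ℂ} (h : IsBranchSystem f g B φ) {q : ℂ × ℂ} (hq : q ∈ B)
    {m : ℕ} (c : Fin m → ℂ) :
    HasGermRelation f g c q ↔ ∃ k : Fin m → Fin (defDeg f g), Function.Injective k ∧
      ∀ q' ∈ B, ∑ i, c i * f.eval (φ (k i) q') = 0 := by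
  constructor
  · rintro ⟨x, hx, hroot, hrel⟩
    choose k hk using fun i => h.complete _ hq (x i) (hroot i)
    refine ⟨k, fun i j hij => hx (by rw [hk, hk, hij]), ?_⟩
    rwa [show x = fun i => φ (k i) q from funext hk, h.germRelation_iff hq] at hrel
  · rintro ⟨k, hk, hrel⟩
    exact ⟨fun i => φ (k i) q, (h.injective q hq).comp hk, fun i => h.root q hq _,
      (h.germRelation_iff hq c k).2 hrel⟩

lemma finite_polyCrit {P : Polynomial ℂ} (hP : P.natDegree ≠ 0) : (polyCrit P).Finite := by
  have hP' : P.derivative ≠ 0 := fun h => hP (derivative_eq_zero.1 h)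
  refine ((P.derivative.roots.toFinset.finite_toSet).image fun w => P.eval w).subset ?_
  rintro t ⟨w, rfl, hw⟩
  exact ⟨w, by simpa [hP'] using hw, rfl⟩

lemma mem_sigmaFin_iff {f g : Polynomial ℂ} {t ε : ℂ} (hc : leadC f g ε ≠ 0) :
    (t, ε) ∈ sigmaFin f g ↔ t ∈ polyCrit (deformation f g ε) := by
  simp [sigmaFin, polyCrit, hc, eval_deformation, eval_derivative_deformation]

lemma finite_sigmaFin_slice {f g : Polynomial ℂ} (hn : 0 < defDeg f g) {ε : ℂ}
    (hc : leadC f g ε ≠ 0) : {t | (t, ε) ∈ sigmaFin f g}.Finite := by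
  simp only [mem_sigmaFin_iff hc]
  exact finite_polyCrit (by rw [natDegree_deformation hc]; omega)

lemma finite_leadC_eq_zero {f g : Polynomial ℂ} {ε₁ : ℂ} (hc : leadC f g ε₁ ≠ 0) :
    {ε | leadC f g ε = 0}.Finite := by
  set P : Polynomial ℂ := C (f.coeff (defDeg f g)) + X * C (g.coeff (defDeg f g)) with hP
  have heval (ε : ℂ) : P.eval ε = leadC f g ε := by simp [hP, leadC]; ring
  have hP0 : P ≠ 0 := by
    rintro h0
    rw [← heval, h0, eval_zero] at hc
    exact hc rfl
  refine P.roots.toFinset.finite_toSet.subset fun ε hε => ?_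
  simpa [hP0, heval] using hε

lemma isPreconnected_compl_of_finite {s : Set ℂ} (hs : s.Finite) : IsPreconnected sᶜ :=
  (hs.countable.isConnected_compl_of_one_lt_rank (by simp)).isPreconnected

/-- The complement of the ramification locus is connected, so relations propagate on it. -/
lemma hasGermRelation_iff {f g : Polynomial ℂ} (hn : 0 < defDeg f g) {m : ℕ} (c : Fin m → ℂ)
    {p p' : ℂ × ℂ} (hp : p ∉ sigmaFin f g) (hp' : p' ∉ sigmaFin f g) :
    HasGermRelation f g c p ↔ HasGermRelation f g c p' := by
  have hlead {p : ℂ × ℂ} (hp : p ∉ sigmaFin f g) : leadC f g p.2 ≠ 0 := fun h => hp (Or.inl h)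
  have hlocal {q : ℂ × ℂ} (hq : q ∉ sigmaFin f g) :
      ∀ᶠ q' in nhds q, q' ∉ sigmaFin f g ∧ (HasGermRelation f g c q' ↔ HasGermRelation f g c q) := by
    obtain ⟨B, φ, hB, h⟩ := exists_isBranchSystem hn hq
    filter_upwards [h.isOpen.mem_nhds hB] with q' hq'
    exact ⟨h.disjoint q' hq', by rw [h.hasGermRelation_iff hq', h.hasGermRelation_iff hB]⟩
  have hvert {t t' ε : ℂ} (ht : (t, ε) ∉ sigmaFin f g) (ht' : (t', ε) ∉ sigmaFin f g) :
      HasGermRelation f g c (t, ε) ↔ HasGermRelation f g c (t', ε) := by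
    refine (isPreconnected_compl_of_finite
      (finite_sigmaFin_slice hn (hlead ht))).iff_of_eventually_iff
      (Q := fun t => HasGermRelation f g c (t, ε)) (fun t ht => ?_) ht ht'
    have hcont : Continuous fun t : ℂ => (t, ε) := by fun_prop
    exact (((hcont.tendsto t).eventually (hlocal ht)).mono fun _ h => h.2).filter_mono
      nhdsWithin_le_nhds
  set Q : ℂ → Prop := fun ε => ∃ t, (t, ε) ∉ sigmaFin f g ∧ HasGermRelation f g c (t, ε) with hQ
  have hQiff {t ε : ℂ} (ht : (t, ε) ∉ sigmaFin f g) : Q ε ↔ HasGermRelation f g c (t, ε) :=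
    ⟨fun ⟨_, h1, h2⟩ => (hvert h1 ht).1 h2, fun h => ⟨t, ht, h⟩⟩
  have hmain := (isPreconnected_compl_of_finite (finite_leadC_eq_zero
    (hlead hp))).iff_of_eventually_iff (Q := Q) (fun ε hε => ?_)
      (show p.2 ∈ _ from hlead hp) (show p'.2 ∈ _ from hlead hp')
  · rw [hQiff (t := p.1) hp, hQiff (t := p'.1) hp'] at hmain
    exact hmain
  · obtain ⟨t, ht⟩ := (finite_sigmaFin_slice hn hε).infinite_compl.nonempty
    have hcont : Continuous fun ε : ℂ => (t, ε) := by fun_prop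
    refine Filter.Eventually.filter_mono nhdsWithin_le_nhds ?_
    filter_upwards [(hcont.tendsto ε).eventually (hlocal ht)] with ε' h'
    rw [hQiff h'.1, h'.2, hQiff ht]

/-- Monodromy preserves relations between the roots. -/
lemma germRelation_iff_of_mem_monodromyGroup {f g : Polynomial ℂ} (hn : 0 < defDeg f g) {m : ℕ}
    (hm : 0 < m) (c : Fin m → ℂ) {t₁ ε₁ : ℂ} {σ : Equiv.Perm (theFiber f g t₁ ε₁)}
    (hσ : σ ∈ MonodromyGroup f g t₁ ε₁) (x : Fin m → theFiber f g t₁ ε₁) :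
    GermRelation f g c (t₁, ε₁) (fun i => (x i : ℂ)) ↔
      GermRelation f g c (t₁, ε₁) (fun i => (σ (x i) : ℂ)) := by
  induction hσ using Subgroup.closure_induction generalizing x with
  | one => rfl
  | mul σ τ _ _ hσ hτ => rw [hτ x, hσ fun i => τ (x i)]; rfl
  | inv σ _ hσ => rw [hσ fun i => σ⁻¹ (x i)]; simp
  | mem σ hσ =>
    obtain ⟨γ, hγ, hγ0, hγ1, hunram, hlift⟩ := hσ
    choose l hl hl0 hl1 hroot using fun i => hlift (x i)
    set γ' : ℝ → ℂ × ℂ := fun s =>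
      (f.eval (l ⟨0, hm⟩ s) + (γ s).2 * g.eval (l ⟨0, hm⟩ s), (γ s).2) with hγ'
    have hfst : ∀ s ∈ Set.Icc (0 : ℝ) 1, ((γ' s).1 : OnePoint ℂ) = (γ s).1 := hroot ⟨0, hm⟩
    have hcont : ContinuousOn γ' (Set.Icc 0 1) := by
      have hev (P : Polynomial ℂ) : ContinuousOn (fun s => P.eval (l ⟨0, hm⟩ s)) (Set.Icc 0 1) :=
        P.continuous.comp_continuousOn (hl _)
      have hsnd : ContinuousOn (fun s => (γ s).2) (Set.Icc 0 1) :=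
        continuous_snd.comp_continuousOn hγ
      exact ((hev f).add (hsnd.mul (hev g))).prodMk hsnd
    have h0 : (0 : ℝ) ∈ Set.Icc (0 : ℝ) 1 := by simp
    have h1 : (1 : ℝ) ∈ Set.Icc (0 : ℝ) 1 := by simp
    have hγ'0 : γ' 0 = (t₁, ε₁) := by
      refine Prod.ext (OnePoint.coe_injective ?_) ?_
      · rw [hfst 0 h0, hγ0]
      · simp [hγ', hγ0]
    have hγ'1 : γ' 1 = (t₁, ε₁) := by
      refine Prod.ext (OnePoint.coe_injective ?_) ?_
      · rw [hfst 1 h1, hγ1]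
      · simp [hγ', hγ1]
    have hmain := germRelation_iff_of_lift hn c (isPreconnected_Icc (a := (0 : ℝ)) (b := 1)) hcont
      (l := fun s i => l i s) (continuousOn_pi.2 hl)
      (fun s hs hmem => hunram s hs (Or.inr ⟨(γ' s).1, (hfst s hs).symm, hmem⟩))
      (fun s hs i => OnePoint.coe_injective ((hroot i s hs).trans (hfst s hs).symm)) h0 h1
    simpa only [hγ'0, hγ'1, hl0, hl1] using hmain

/-- A function killed by all translates of a nonzero vector of zero sum under a two-transitive
group is constant. -/
lemma IsTwoTransitive.eq_of_sum_eq_zero {X : Type*} [Fintype X] {G : Subgroup (Equiv.Perm X)}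
    (hG : IsTwoTransitive G) {b F : X → ℂ} (hb : ∑ w, b w = 0) {w₀ : X} (hw₀ : b w₀ ≠ 0)
    (hF : ∀ σ ∈ G, ∑ w, b w * F (σ w) = 0) (u v : X) : F u = F v := by
  classical
  obtain ⟨w₁, hw₁⟩ : ∃ w₁, w₁ ≠ w₀ := by
    by_contra! h
    rw [Finset.sum_eq_single w₀ (fun w _ hw => absurd (h w) hw) (by simp)] at hb
    exact hw₀ hb
  have key (u : X) : ∑ w, F w = Fintype.card X * F u := by
    set S : Finset (Equiv.Perm X) := {σ | σ ∈ G ∧ σ w₀ = u} with hS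
    have hSmem (σ : Equiv.Perm X) : σ ∈ S ↔ σ ∈ G ∧ σ w₀ = u := by simp [hS]
    obtain ⟨u', hu'⟩ : ∃ u', u' ≠ u := by
      by_contra! h
      exact hw₁ ((h w₁).trans (h w₀).symm)
    have hSne : (S.card : ℂ) ≠ 0 := by
      obtain ⟨σ, hσ, hσu, -⟩ := hG w₀ w₁ u u' hw₁.symm hu'.symm
      exact Nat.cast_ne_zero.2 (Finset.card_ne_zero_of_mem ((hSmem σ).2 ⟨hσ, hσu⟩))
    have hbase : ∑ σ ∈ S, F (σ w₀) = S.card * F u := by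
      rw [Finset.sum_congr rfl fun σ hσ => by rw [((hSmem σ).1 hσ).2]]
      simp
    have hconst (w : X) (hw : w ≠ w₀) : ∑ σ ∈ S, F (σ w) = ∑ σ ∈ S, F (σ w₁) := by
      obtain ⟨τ, hτ, hτ₀, hτw⟩ := hG w₀ w₁ w₀ w hw₁.symm hw.symm
      refine Finset.sum_equiv (Equiv.mulRight τ) (fun σ => ?_) fun σ _ => ?_
      · simp [hSmem, Subgroup.mul_mem_cancel_right G hτ, hτ₀]
      · simp [hτw]
    have hrel : ∑ w, b w * ∑ σ ∈ S, F (σ w) = 0 := by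
      simp only [Finset.mul_sum]
      rw [Finset.sum_comm]
      exact Finset.sum_eq_zero fun σ hσ => hF σ ((hSmem σ).1 hσ).1
    have hdiff : ∑ w, b w * (∑ σ ∈ S, F (σ w) - ∑ σ ∈ S, F (σ w₁)) = 0 := by
      simp only [mul_sub, Finset.sum_sub_distrib, hrel, ← Finset.sum_mul, hb, zero_mul, sub_zero]
    rw [Finset.sum_eq_single w₀ (fun w _ hw => by rw [hconst w hw, sub_self, mul_zero])
      (by simp), mul_eq_zero, or_iff_right hw₀, sub_eq_zero, hbase] at hdiff
    have hall (w : X) : ∑ σ ∈ S, F (σ w) = S.card * F u := by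
      by_cases hw : w = w₀
      · rw [hw, hbase]
      · rw [hconst w hw, hdiff]
    have htotal : ∑ w, ∑ σ ∈ S, F (σ w) = S.card * ∑ w, F w := by
      rw [Finset.sum_comm, Finset.sum_congr rfl fun σ _ => Equiv.sum_comp σ F]
      simp
    simp only [hall, Finset.sum_const, Finset.card_univ, nsmul_eq_mul] at htotal
    refine mul_left_cancel₀ hSne ?_
    rw [← htotal]
    ring
  have hX : (Fintype.card X : ℂ) ≠ 0 := Nat.cast_ne_zero.2 (Fintype.card_pos_iff.2 ⟨u⟩).ne'
  exact mul_left_cancel₀ hX ((key u).symm.trans (key v))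

/-- If a nontrivial relation holds between the roots and the monodromy is two-transitive, then
`f` is constant on some fiber of the deformation with `ε ≠ 0`. -/
lemma exists_fiber_const {f g : Polynomial ℂ} (hn : 0 < defDeg f g) {m : ℕ} (c : Fin m → ℂ)
    (hsum : ∑ i, c i = 0) {i₀ : Fin m} (hi₀ : c i₀ ≠ 0) {t₁ ε₁ : ℂ}
    (hbase : (t₁, ε₁) ∉ sigmaFin f g) (htrans : IsTwoTransitive (MonodromyGroup f g t₁ ε₁))
    (hrel : HasGermRelation f g c (t₁, ε₁)) :
    ∃ (q : ℂ × ℂ) (y : Fin (defDeg f g) → ℂ), q.2 ≠ 0 ∧ Function.Injective y ∧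
      (∀ k, f.eval (y k) + q.2 * g.eval (y k) = q.1) ∧ ∀ k k', f.eval (y k) = f.eval (y k') := by
  obtain ⟨B, φ, hB, h⟩ := exists_isBranchSystem hn hbase
  obtain ⟨x, hx, hroot, hgerm⟩ := hrel
  obtain ⟨q, hq, hq0⟩ : ∃ q ∈ B, q.2 ≠ 0 := by
    have hcont : Continuous fun ε : ℂ => (t₁, ε) := by fun_prop
    have hnhds : (fun ε : ℂ => (t₁, ε)) ⁻¹' B ∈ nhds ε₁ := hcont.continuousAt (h.isOpen.mem_nhds hB)
    obtain ⟨ε, hε, hε0⟩ := (infinite_of_mem_nhds ε₁ hnhds).exists_notMem_finite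
      (Set.finite_singleton 0)
    exact ⟨(t₁, ε), hε, hε0⟩
  refine ⟨q, fun k => φ k q, hq0, h.injective q hq, h.root q hq, ?_⟩
  let e : Fin (defDeg f g) ≃ theFiber f g t₁ ε₁ := Equiv.ofBijective
    (fun k => ⟨φ k (t₁, ε₁), h.root _ hB k⟩)
    ⟨fun k k' hk => h.injective _ hB (congrArg Subtype.val hk), fun w => by
      obtain ⟨k, hk⟩ := h.complete _ hB w.1 w.2
      exact ⟨k, Subtype.ext hk.symm⟩⟩
  have he (w : theFiber f g t₁ ε₁) : φ (e.symm w) (t₁, ε₁) = w.1 :=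
    congrArg Subtype.val (e.apply_symm_apply w)
  have : Fintype (theFiber f g t₁ ε₁) := Fintype.ofEquiv _ e
  let x' : Fin m → theFiber f g t₁ ε₁ := fun i => ⟨x i, hroot i⟩
  have hx' : Function.Injective x' := fun i j hij => hx (congrArg Subtype.val hij)
  let b : theFiber f g t₁ ε₁ → ℂ := Function.extend x' c 0
  have hbsum (F : theFiber f g t₁ ε₁ → ℂ) : ∑ w, b w * F w = ∑ i, c i * F (x' i) := by
    symm
    refine Fintype.sum_of_injective x' hx' _ _ (fun w hw => ?_) fun i => ?_
    · simp only [b]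
      rw [Function.extend_apply' _ _ _ (by simpa using hw)]
      simp
    · simp only [b]
      rw [hx'.extend_apply]
  have hconst := htrans.eq_of_sum_eq_zero (b := b)
    (F := fun w => f.eval (φ (e.symm w) q)) (w₀ := x' i₀)
    (by simpa [hsum] using hbsum fun _ => 1)
    (by simpa only [b, hx'.extend_apply] using hi₀)
    (fun σ hσ => by
      have hσrel := (germRelation_iff_of_mem_monodromyGroup hn i₀.pos c hσ x').1 hgerm
      rw [hbsum fun w => f.eval (φ (e.symm (σ w)) q)]
      rw [show (fun i => (σ (x' i) : ℂ)) = fun i => φ (e.symm (σ (x' i))) (t₁, ε₁) from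
        funext fun i => (he _).symm, h.germRelation_iff hB] at hσrel
      exact hσrel q hq)
  intro k k'
  simpa using hconst (e k) (e k')

/-- If `f` is constant on a fiber of the deformation with `ε ≠ 0`, then `g` is affine in `f`. -/
lemma exists_affine_of_fiber_const {f g : Polynomial ℂ} (hf : 0 < f.natDegree) {q : ℂ × ℂ}
    {y : Fin (defDeg f g) → ℂ} (hq : q.2 ≠ 0)
    (hy : Function.Injective y) (hroot : ∀ k, f.eval (y k) + q.2 * g.eval (y k) = q.1)
    (hconst : ∀ k k', f.eval (y k) = f.eval (y k')) :
    ∃ α β : ℂ, g = C α * f + C β := by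
  have hle : f.natDegree ≤ defDeg f g := le_max_left _ _
  have hn : 0 < defDeg f g := hf.trans_le hle
  set v := f.eval (y ⟨0, hn⟩) with hv
  have hfy (k) : f.eval (y k) = v := hconst _ _
  have hzero (P : Polynomial ℂ) (hP : P.degree < defDeg f g) (hPy : ∀ k, P.eval (y k) = 0) :
      P = 0 := by
    refine eq_zero_of_degree_lt_of_eval_finset_eq_zero (Finset.univ.map ⟨y, hy⟩) (by simpa) ?_
    simpa using hPy
  have hdeg : f.natDegree = defDeg f g := by
    by_contra hne
    have h0 : f - C v = 0 := by
      refine hzero _ (degree_le_natDegree.trans_lt ?_) (by simp [hfy])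
      rw [natDegree_sub_C]
      exact Nat.cast_lt.2 (lt_of_le_of_ne hle hne)
    have := congrArg natDegree h0
    rw [natDegree_sub_C, natDegree_zero] at this
    omega
  have hlead : f.leadingCoeff ≠ 0 := leadingCoeff_ne_zero.2 fun h => by simp [h] at hf
  set α := g.coeff (defDeg f g) / f.leadingCoeff with hα
  set u := (q.1 - v) / q.2 with hu
  have hgy (k) : g.eval (y k) = u := by
    rw [hu, eq_div_iff hq, ← hroot k, hfy]
    ring
  have h0 : g - C α * f - C (u - α * v) = 0 := by
    refine hzero _ ?_ (fun k => by simp [hgy, hfy])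
    rw [degree_lt_iff_coeff_zero]
    intro j hj
    rcases hj.lt_or_eq with hj | rfl
    · have hgle : g.natDegree ≤ defDeg f g := le_max_right _ _
      simp [coeff_C, show j ≠ 0 by omega, coeff_eq_zero_of_natDegree_lt (hgle.trans_lt hj),
        coeff_eq_zero_of_natDegree_lt (hle.trans_lt hj)]
    · have : f.coeff (defDeg f g) = f.leadingCoeff := by rw [leadingCoeff, hdeg]
      simp [coeff_C, hn.ne', this, hα, hlead]
  refine ⟨α, u - α * v, ?_⟩
  linear_combination h0

open Metric in
/-- A relation between continuous branches over a polydisc yields a germ relation off the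
ramification locus. -/
lemma hasGermRelation_of_branches {f g : Polynomial ℂ} (hn : 0 < defDeg f g) {ε₁ : ℂ}
    (hc₁ : leadC f g ε₁ ≠ 0) {m : ℕ} (c : Fin m → ℂ) {t₀ : ℂ} {δ r : ℝ} (hδ : 0 < δ) (hr : 0 < r)
    {z : Fin m → ℂ → ℂ → ℂ}
    (hcont : ∀ i, ContinuousOn (fun p : ℂ × ℂ => z i p.1 p.2) (ball t₀ δ ×ˢ ball 0 r))
    (hroot : ∀ i, ∀ t ∈ ball t₀ δ, ∀ ε ∈ ball (0 : ℂ) r,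
      f.eval (z i t ε) + ε * g.eval (z i t ε) = t)
    (hsep : ∀ i j, i ≠ j → ∀ t ∈ ball t₀ δ, ∀ ε ∈ ball (0 : ℂ) r, z i t ε ≠ z j t ε)
    (hrel : ∀ t ∈ ball t₀ δ, ∀ ε ∈ ball (0 : ℂ) r, ∑ i, c i * f.eval (z i t ε) = 0) :
    ∃ p, p ∉ sigmaFin f g ∧ HasGermRelation f g c p := by
  obtain ⟨ε, hε, hεc⟩ := (infinite_of_mem_nhds (0 : ℂ) (ball_mem_nhds _ hr)).exists_notMem_finite
    (finite_leadC_eq_zero hc₁)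
  obtain ⟨t, ht, ht_unram⟩ := (infinite_of_mem_nhds t₀ (ball_mem_nhds _ hδ)).exists_notMem_finite
    (finite_sigmaFin_slice hn hεc)
  have hp : ((t, ε) : ℂ × ℂ) ∉ sigmaFin f g := ht_unram
  obtain ⟨B, φ, hB, h⟩ := exists_isBranchSystem hn hp
  choose k hk using fun i => h.complete _ hB (z i t ε) (hroot i t ht ε hε)
  refine ⟨(t, ε), hp, fun i => z i t ε, fun i j hij => ?_, fun i => hroot i t ht ε hε, ?_⟩
  · by_contra hne
    exact hsep i j hne t ht ε hε hij
  have hD : ball t₀ δ ×ˢ ball (0 : ℂ) r ∈ nhds (t, ε) :=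
    (isOpen_ball.prod isOpen_ball).mem_nhds ⟨ht, hε⟩
  have hfollow : ∀ᶠ q : ℂ × ℂ in nhds (t, ε), ∀ i, z i q.1 q.2 = φ (k i) q := by
    refine Filter.eventually_all.2 fun i => h.eventually_eq hB Filter.tendsto_id ?_ ?_
    · rw [← hk]
      exact (hcont i).continuousAt hD
    · filter_upwards [hD] with q hq using hroot i q.1 hq.1 q.2 hq.2
  have hzero : ∀ᶠ q : ℂ × ℂ in nhds (t, ε), ∑ i, c i * f.eval (φ (k i) q) = 0 := by
    filter_upwards [hfollow, hD] with q h1 h2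
    simp only [← h1]
    exact hrel q.1 h2.1 q.2 h2.2
  rw [funext hk, h.germRelation_iff hB]
  exact h.sum_eq_zero hB hzero

/-- The composition condition makes the displacement vanish. -/
lemma sum_mul_comp_eq_zero {ι : Type*} [Fintype ι] {a : ι → ℤ} {ζ : ι → ℂ} {p h : Polynomial ℂ}
    (hproj : ∀ i, ∑ j ∈ Finset.univ.filter fun j => h.eval (ζ j) = h.eval (ζ i), a j = 0) :
    ∑ i, (a i : ℂ) * (p.comp h).eval (ζ i) = 0 := by
  classical
  rw [← Finset.sum_fiberwise_of_maps_to (s := Finset.univ)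
    (t := Finset.univ.image fun i => h.eval (ζ i)) (g := fun i => h.eval (ζ i)) (by simp)]
  refine Finset.sum_eq_zero fun v hv => ?_
  obtain ⟨i, -, rfl⟩ := Finset.mem_image.1 hv
  rw [Finset.sum_congr rfl fun j hj => by rw [eval_comp, (Finset.mem_filter.1 hj).2],
    ← Finset.sum_mul, ← Int.cast_sum]
  convert zero_mul _
  exact_mod_cast hproj i

/-!
STATEMENT 7 (Proposition: the two-transitive case).

Suppose the monodromy group `G` of the deformation `f + ε g` is two-transitive,
and let `C` be a zero cycle of `f` (branches of the deformation modelled on a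
polydisc around a regular value `t₀` of `f`, as in STATEMENT 0).  Then `f + ε g`
has an infinitesimal center for `C` (i.e. `Δ(t,ε) ≡ 0` for regular `t` and small
`ε`) if and only if `f`, `g`, `C` satisfy the composition condition.
-/
open Metric Finset in
theorem two_transitive_infinitesimal_center_iff_composition
    (f g : Polynomial ℂ) (t₁ ε₁ : ℂ)
    (hbase : ((t₁ : OnePoint ℂ), ε₁) ∉ sigmaSet f g)
    (htrans : IsTwoTransitive (MonodromyGroup f g t₁ ε₁))
    (m : ℕ) (hm : 1 ≤ m) (hdeg : f.natDegree = m)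
    (a : Fin m → ℤ) (hcycle : ∑ i, a i = 0)
    (t₀ : ℂ) (δ r : ℝ) (hδ : 0 < δ) (hr : 0 < r)
    (hreg : ∀ w : ℂ, f.eval w = t₀ → f.derivative.eval w ≠ 0)
    (z : Fin m → ℂ → ℂ → ℂ)
    (hcont : ∀ i, ContinuousOn (fun p : ℂ × ℂ => z i p.1 p.2) (ball t₀ δ ×ˢ ball 0 r))
    (hroot : ∀ i, ∀ t ∈ ball t₀ δ, ∀ ε ∈ ball (0 : ℂ) r,
      f.eval (z i t ε) + ε * g.eval (z i t ε) = t)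
    (hsep : ∀ i j, i ≠ j → ∀ t ∈ ball t₀ δ, ∀ ε ∈ ball (0 : ℂ) r, z i t ε ≠ z j t ε) :
    (∀ t ∈ ball t₀ δ, ∀ ε ∈ ball (0 : ℂ) r,
        ∑ i, (a i : ℂ) * f.eval (z i t ε) = 0)
      ↔ ∃ ftil gtil h : Polynomial ℂ,
          f = ftil.comp h ∧ g = gtil.comp h ∧
          ∀ t ∈ ball t₀ δ, ∀ ε ∈ ball (0 : ℂ) r, ∀ i,
            ∑ j ∈ univ.filter fun j => h.eval (z j t ε) = h.eval (z i t ε), a j = 0 := by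
  have hf : 0 < f.natDegree := by omega
  have hn : 0 < defDeg f g := hf.trans_le (le_max_left _ _)
  have hbase' : (t₁, ε₁) ∉ sigmaFin f g := fun h => hbase (Or.inr ⟨t₁, rfl, h⟩)
  constructor
  · intro hΔ
    by_cases ha : ∀ i, a i = 0
    · exact ⟨f, g, X, by simp, by simp, fun t _ ε _ i => sum_eq_zero fun j _ => ha j⟩
    push Not at ha
    obtain ⟨i₀, hi₀⟩ := ha
    obtain ⟨p, hp, hprel⟩ := hasGermRelation_of_branches hn (fun h => hbase' (Or.inl h))
      (fun i => (a i : ℂ)) hδ hr hcont hroot hsep hΔ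
    obtain ⟨q, y, hq0, hy, hyroot, hyconst⟩ := exists_fiber_const hn (fun i => (a i : ℂ))
      (by exact_mod_cast hcycle) (Int.cast_ne_zero.2 hi₀) hbase' htrans
      ((hasGermRelation_iff hn _ hp hbase').1 hprel)
    obtain ⟨α, β, hg⟩ := exists_affine_of_fiber_const hf hq0 hy hyroot hyconst
    refine ⟨X, C α * X + C β, f, by simp, by simp [hg], fun t ht ε hε i => ?_⟩
    have hval (j : Fin m) {t' : ℂ} (ht' : t' ∈ ball t₀ δ) :
        (1 + ε * α) * f.eval (z j t' ε) = t' - ε * β := by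
      have := hroot j t' ht' ε hε
      simp only [hg, eval_add, eval_mul, eval_C] at this
      linear_combination this
    have hne : 1 + ε * α ≠ 0 := by
      intro h0
      obtain ⟨t', ht', htt'⟩ := (infinite_of_mem_nhds t₀
        (ball_mem_nhds _ hδ)).exists_notMem_finite (Set.finite_singleton t)
      refine htt' ?_
      have h1 := hval i ht
      have h2 := hval i ht'
      rw [h0, zero_mul] at h1 h2
      exact sub_left_injective (h2.symm.trans h1)
    rw [filter_true_of_mem fun j _ => mul_left_cancel₀ hne ((hval j ht).trans (hval i ht).symm),
      hcycle]
  · rintro ⟨ftil, gtil, h, hfh, -, hproj⟩ t ht ε hε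
    rw [hfh]
    exact sum_mul_comp_eq_zero (hproj t ht ε hε)

end
end

section
/- Let f, g ∈ ℂ[z] with n = deg_z(f + εg), suppose the monodromy group G of f + εg is two-transitive, and suppose Δ(t,ε) ≡ 0 along a zero cycle C = Σ n_i z_i. If n_i ≠ 0 then, averaging f over the G-orbit of C under the stabilizer of the fiber z_i, one gets f(z_i(t,ε)) = (1/(n−1)) Σ_{j ≠ i} f(z_j(t,ε)); consequently, if n_i ≠ 0 and n_j ≠ 0 for two indices i ≠ j, then f(z_i(t,ε)) = f(z_j(t,ε)) as elements of ℂ(z_1,…,z_n). -/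
open Polynomial OnePoint

noncomputable section

section RootBranches

open Filter Topology

/-- `φ` is a germ at `p` of a continuous root branch of `f + ε g = t`. -/
def IsRootBranch (f g : Polynomial ℂ) (p : ℂ × ℂ) (φ : ℂ × ℂ → ℂ) : Prop :=
  ContinuousAt φ p ∧ ∀ᶠ q in 𝓝 p, f.eval (φ q) + q.2 * g.eval (φ q) = q.1

/-- Near a simple root `w`, the solution set of `f(y) + ε g(y) = t` is the graph of an
analytic function of `(t, ε)`. -/
lemma exists_analytic_rootBranch (f g : Polynomial ℂ) {p : ℂ × ℂ} {w : ℂ}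
    (hw : f.eval w + p.2 * g.eval w = p.1)
    (hd : f.derivative.eval w + p.2 * g.derivative.eval w ≠ 0) :
    ∃ φ : ℂ × ℂ → ℂ, AnalyticAt ℂ φ p ∧ φ p = w ∧ IsRootBranch f g p φ ∧
      ∀ᶠ y in 𝓝 (w, p), f.eval y.1 + y.2.2 * g.eval y.1 = y.2.1 → φ y.2 = y.1 := by
  set A := f.derivative.eval w + p.2 * g.derivative.eval w with hA
  set B := g.eval w with hB
  let D : (ℂ × ℂ) ≃L[ℂ] (ℂ × ℂ) := ContinuousLinearEquiv.equivOfInverse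
    ((A • ContinuousLinearMap.fst ℂ ℂ ℂ + B • ContinuousLinearMap.snd ℂ ℂ ℂ).prod
      (ContinuousLinearMap.snd ℂ ℂ ℂ))
    ((A⁻¹ • (ContinuousLinearMap.fst ℂ ℂ ℂ - B • ContinuousLinearMap.snd ℂ ℂ ℂ)).prod
      (ContinuousLinearMap.snd ℂ ℂ ℂ))
    (fun x => by ext <;> simp [hd]) (fun x => by ext <;> simp [hd])
  let Φ : ℂ × ℂ → ℂ × ℂ := fun x => (f.eval x.1 + x.2 * g.eval x.1, x.2)
  have hΦp : Φ (w, p.2) = p := Prod.ext hw rfl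
  have hC : ContDiffAt ℂ ⊤ Φ (w, p.2) := by
    have h (P : Polynomial ℂ) : ContDiffAt ℂ ⊤ (fun x : ℂ × ℂ => P.eval x.1) (w, p.2) :=
      ((P.contDiff_aeval ⊤).comp contDiff_fst).contDiffAt
    exact ((h f).add (contDiffAt_snd.mul (h g))).prodMk contDiffAt_snd
  have hF : HasFDerivAt Φ (D : (ℂ × ℂ) →L[ℂ] (ℂ × ℂ)) (w, p.2) := by
    have h (P : Polynomial ℂ) := (P.hasDerivAt w).comp_hasFDerivAt (𝕜 := ℂ) (w, p.2)
      (hasFDerivAt_fst (𝕜 := ℂ) (p := (w, p.2)))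
    have := ((h f).add ((hasFDerivAt_snd (𝕜 := ℂ) (p := (w, p.2))).mul (h g))).prodMk
      (hasFDerivAt_snd (𝕜 := ℂ) (p := (w, p.2)))
    convert! this using 1
    ext <;> simp [D, hA, hB]
  have hn : (⊤ : WithTop ℕ∞) ≠ 0 := by simp
  have hS := hC.hasStrictFDerivAt' hF hn
  have hT : Tendsto (fun y : ℂ × ℂ × ℂ => (y.1, y.2.2)) (𝓝 (w, p)) (𝓝 (w, p.2)) :=
    Continuous.tendsto (f := fun y : ℂ × ℂ × ℂ => (y.1, y.2.2)) (by fun_prop) (w, p)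
  have hL : AnalyticAt ℂ (hC.localInverse hF hn) p := by
    have := hC.to_localInverse hF hn
    rw [hΦp] at this
    exact this.analyticAt
  have hval : hC.localInverse hF hn p = (w, p.2) := by
    have := hC.localInverse_apply_image hF hn
    rwa [hΦp] at this
  have hright : ∀ᶠ q in 𝓝 p, Φ (hC.localInverse hF hn q) = q := by
    have := hS.eventually_right_inverse
    rwa [hΦp] at this
  have hφ : AnalyticAt ℂ (fun q => (hC.localInverse hF hn q).1) p := analyticAt_fst.comp hL
  refine ⟨_, hφ, by simp [hval], ⟨hφ.continuousAt, ?_⟩, ?_⟩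
  · filter_upwards [hright] with q hq
    have h1 := congrArg Prod.fst hq
    have h2 := congrArg Prod.snd hq
    simp only [Φ] at h1 h2
    rwa [h2] at h1
  · filter_upwards [hT.eventually hS.eventually_left_inverse] with y hy hsol
    have hy' : Φ (y.1, y.2.2) = y.2 := Prod.ext hsol rfl
    rw [hy'] at hy
    exact congrArg Prod.fst hy

/-- A family of roots that tends to a simple root eventually follows the branch through it. -/
lemma IsRootBranch.eventually_eq {f g : Polynomial ℂ} {p : ℂ × ℂ} {φ : ℂ × ℂ → ℂ}
    (hφ : IsRootBranch f g p φ)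
    (hd : f.derivative.eval (φ p) + p.2 * g.derivative.eval (φ p) ≠ 0)
    {α : Type*} {F : Filter α} {u : α → ℂ × ℂ} {v : α → ℂ} (hu : Tendsto u F (𝓝 p))
    (hv : Tendsto v F (𝓝 (φ p)))
    (hsol : ∀ᶠ s in F, f.eval (v s) + (u s).2 * g.eval (v s) = (u s).1) :
    ∀ᶠ s in F, φ (u s) = v s := by
  obtain ⟨ψ, -, -, -, hψ⟩ := exists_analytic_rootBranch f g hφ.2.self_of_nhds hd
  have h1 := (hv.prodMk_nhds hu).eventually hψ
  have h2 := (((hφ.1.tendsto.comp hu).prodMk_nhds hu)).eventually hψ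
  filter_upwards [h1, h2, hsol, hu.eventually hφ.2] with s h1 h2 h3 h4
  exact (h2 h4).symm.trans (h1 h3)

lemma IsRootBranch.analyticAt {f g : Polynomial ℂ} {p : ℂ × ℂ} {φ : ℂ × ℂ → ℂ}
    (hφ : IsRootBranch f g p φ)
    (hd : f.derivative.eval (φ p) + p.2 * g.derivative.eval (φ p) ≠ 0) :
    AnalyticAt ℂ φ p := by
  obtain ⟨ψ, hψ, hψp, hψb, -⟩ := exists_analytic_rootBranch f g hφ.2.self_of_nhds hd
  exact hψ.congr ((hφ.eventually_eq hd tendsto_id (hψp ▸ hψb.1.tendsto) hψb.2).mono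
    fun _ h => h.symm)

lemma analyticAt_sum_mul_eval {ι : Type*} [Fintype ι] (f : Polynomial ℂ) (b : ι → ℂ)
    {φ : ι → ℂ × ℂ → ℂ} {p : ℂ × ℂ} (hφ : ∀ i, AnalyticAt ℂ (φ i) p) :
    AnalyticAt ℂ (fun q => ∑ i, b i * f.eval (φ i q)) p :=
  Finset.univ.analyticAt_fun_sum fun i _ =>
    analyticAt_const.mul ((hφ i).aeval_polynomial f)

/-- A linear relation between the values of `f` on root branches is preserved under
continuation along a path avoiding the discriminant. -/
lemma relation_continuation {ι : Type*} [Fintype ι] {f g : Polynomial ℂ}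
    {p : unitInterval → ℂ × ℂ} (hp : Continuous p) {l : ι → unitInterval → ℂ}
    (hl : ∀ i, Continuous (l i))
    (hsol : ∀ i s, f.eval (l i s) + (p s).2 * g.eval (l i s) = (p s).1)
    (hd : ∀ i s, f.derivative.eval (l i s) + (p s).2 * g.derivative.eval (l i s) ≠ 0)
    (b : ι → ℂ) {φ ψ : ι → ℂ × ℂ → ℂ}
    (hφ : ∀ i, IsRootBranch f g (p 0) (φ i)) (hφ0 : ∀ i, φ i (p 0) = l i 0)
    (hψ : ∀ i, IsRootBranch f g (p 1) (ψ i)) (hψ1 : ∀ i, ψ i (p 1) = l i 1) :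
    (∀ᶠ q in 𝓝 (p 0), ∑ i, b i * f.eval (φ i q) = 0) ↔
      ∀ᶠ q in 𝓝 (p 1), ∑ i, b i * f.eval (ψ i q) = 0 := by
  choose χ hχan hχv hχb _ using fun s i => exists_analytic_rootBranch f g (hsol i s) (hd i s)
  have hcongr {s : unitInterval} {P : ι → ℂ × ℂ → ℂ}
      (hP : ∀ i, IsRootBranch f g (p s) (P i)) (hPs : ∀ i, P i (p s) = l i s) :
      (∀ᶠ q in 𝓝 (p s), ∑ i, b i * f.eval (P i q) = 0) ↔
        ∀ᶠ q in 𝓝 (p s), ∑ i, b i * f.eval (χ s i q) = 0 := by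
    have h : ∀ᶠ q in 𝓝 (p s), ∀ i, χ s i q = P i q :=
      eventually_all.mpr fun i => (hχb s i).eventually_eq (by rw [hχv]; exact hd i s) tendsto_id
        (by rw [hχv, ← hPs i]; exact (hP i).1) (hP i).2
    refine eventually_congr (h.mono fun q hq => ?_)
    simp only [hq]
  rw [hcongr hφ hφ0, hcongr hψ hψ1]
  suffices IsLocallyConstant
      (fun s => ∀ᶠ q in 𝓝 (p s), ∑ i, b i * f.eval (χ s i q) = 0) from
    iff_of_eq (this.apply_eq_of_preconnectedSpace 0 1)
  refine (IsLocallyConstant.iff_eventually_eq _).mpr fun s => ?_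
  have hbr : ∀ᶠ q in 𝓝 (p s), (∀ i, IsRootBranch f g q (χ s i)) ∧
      AnalyticAt ℂ (fun q => ∑ i, b i * f.eval (χ s i q)) q := by
    refine (eventually_all.mpr fun i => ?_).and
      (analyticAt_sum_mul_eval f b (hχan s)).eventually_analyticAt
    exact ((hχan s i).eventually_analyticAt.mono fun _ h => h.continuousAt).and
      (hχb s i).2.eventually_nhds
  obtain ⟨ρ, hρ, hball⟩ := Metric.eventually_nhds_iff_ball.mp hbr
  have hfollow : ∀ᶠ s' in 𝓝 s, ∀ i, χ s i (p s') = l i s' :=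
    eventually_all.mpr fun i => (hχb s i).eventually_eq (by rw [hχv]; exact hd i s)
      hp.continuousAt (by rw [hχv]; exact (hl i).continuousAt) (.of_forall (hsol i))
  filter_upwards [hfollow, hp.continuousAt.eventually (Metric.ball_mem_nhds _ hρ)]
    with s' hs' hmem
  refine propext ?_
  rw [← hcongr (hball _ hmem).1 hs']
  have han : AnalyticOnNhd ℂ (fun q => ∑ i, b i * f.eval (χ s i q)) (Metric.ball (p s) ρ) :=
    fun q hq => (hball q hq).2
  have hpre := (convex_ball (p s) ρ).isPreconnected
  constructor <;> intro h
  · exact (han.eqOn_zero_of_preconnected_of_eventuallyEq_zero hpre hmem h).eventuallyEq_of_mem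
      (Metric.ball_mem_nhds _ hρ)
  · exact (han.eqOn_zero_of_preconnected_of_eventuallyEq_zero hpre
      (Metric.mem_ball_self hρ) h).eventuallyEq_of_mem (Metric.isOpen_ball.mem_nhds hmem)

/-- The values of `f` on the branches through the points of a fiber satisfy the same linear
relations after the branches are permuted by monodromy. -/
lemma IsMonodromyPerm.relation_iff {f g : Polynomial ℂ} {t₀ ε₀ : ℂ}
    [Fintype (theFiber f g t₀ ε₀)] {σ : Equiv.Perm (theFiber f g t₀ ε₀)}
    (hσ : IsMonodromyPerm f g t₀ ε₀ σ) {F : theFiber f g t₀ ε₀ → ℂ × ℂ → ℂ}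
    (hF : ∀ x, IsRootBranch f g (t₀, ε₀) (F x)) (hF₀ : ∀ x, F x (t₀, ε₀) = x.1)
    (b : theFiber f g t₀ ε₀ → ℂ) :
    (∀ᶠ q in 𝓝 (t₀, ε₀), ∑ x, b x * f.eval (F x q) = 0) ↔
      ∀ᶠ q in 𝓝 (t₀, ε₀), ∑ x, b x * f.eval (F (σ x) q) = 0 := by
  obtain ⟨γ, hγ, hγ0, hγ1, hγs, hlift⟩ := hσ
  choose l hlc hl0 hl1 hl using hlift
  rcases isEmpty_or_nonempty (theFiber f g t₀ ε₀) with hX | ⟨⟨x₀⟩⟩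
  · simp
  let p : unitInterval → ℂ × ℂ := fun s =>
    (f.eval (l x₀ s) + (γ s).2 * g.eval (l x₀ s), (γ s).2)
  have hlc' (x) : Continuous fun s : unitInterval => l x s :=
    continuousOn_iff_continuous_domRestrict.mp (hlc x)
  have hγ2 : Continuous fun s : unitInterval => (γ s).2 :=
    continuous_snd.comp (continuousOn_iff_continuous_domRestrict.mp hγ)
  have hp : Continuous p := by
    have h (P : Polynomial ℂ) := P.continuous.comp (hlc' x₀)
    exact ((h f).add (hγ2.mul (h g))).prodMk hγ2
  have hsol (x) (s : unitInterval) : f.eval (l x s) + (p s).2 * g.eval (l x s) = (p s).1 :=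
    OnePoint.coe_injective ((hl x s s.2).trans (hl x₀ s s.2).symm)
  have hd (x) (s : unitInterval) :
      f.derivative.eval (l x s) + (p s).2 * g.derivative.eval (l x s) ≠ 0 := fun h =>
    hγs s s.2 (Or.inr ⟨_, (hl x s s.2).symm, Or.inr ⟨l x s, rfl, h⟩⟩)
  have hp0 : p 0 = (t₀, ε₀) := by
    have h := x₀.2
    ext1 <;> simp [p, hγ0, hl0, h]
  have hp1 : p 1 = (t₀, ε₀) := by
    have h := (σ x₀).2
    ext1 <;> simp [p, hγ1, hl1, h]
  have := relation_continuation hp hlc' hsol hd b (φ := F) (ψ := fun x => F (σ x))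
    (fun x => by rw [hp0]; exact hF x) (fun x => by rw [hp0, hF₀]; simp [hl0])
    (fun x => by rw [hp1]; exact hF (σ x)) (fun x => by rw [hp1, hF₀]; simp [hl1])
  rwa [hp0, hp1] at this

end RootBranches

/-- A property of functions that is invariant under generators of a permutation group is
invariant under the group. -/
lemma Subgroup.iff_comp_of_mem_closure {X α : Type*} {S : Set (Equiv.Perm X)}
    {R : (X → α) → Prop} (h : ∀ σ ∈ S, ∀ b, R b ↔ R (b ∘ σ)) :
    ∀ σ ∈ Subgroup.closure S, ∀ b, R b ↔ R (b ∘ σ) := by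
  intro σ hσ
  induction hσ using Subgroup.closure_induction with
  | mem σ hσ => exact h σ hσ
  | one => exact fun b => Iff.rfl
  | mul σ τ _ _ hσ hτ => exact fun b => (hσ b).trans (hτ (b ∘ σ))
  | inv σ _ hσ =>
    intro b
    rw [hσ (b ∘ ⇑σ⁻¹)]
    have : (b ∘ ⇑σ⁻¹) ∘ ⇑σ = b := by ext x; simp
    rw [this]

/-- The averaging argument: averaging a relation over the stabilizer of `x₀` in a
two-transitive group. -/
lemma IsTwoTransitive.eq_average {X : Type*} [Fintype X] [DecidableEq X]
    {G : Subgroup (Equiv.Perm X)} (hG : IsTwoTransitive G) (hX : 2 ≤ Fintype.card X)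
    {b v : X → ℂ} (hb : ∑ x, b x = 0) (hv : ∀ σ ∈ G, ∑ x, b (σ x) * v x = 0)
    {x₀ : X} (hx₀ : b x₀ ≠ 0) :
    v x₀ = (1 / ((Fintype.card X : ℂ) - 1)) * ∑ x ∈ Finset.univ.erase x₀, v x := by
  classical
  set H : Finset (Equiv.Perm X) := {σ | σ ∈ G ∧ σ x₀ = x₀} with hH
  have hmem (σ : Equiv.Perm X) : σ ∈ H ↔ σ ∈ G ∧ σ x₀ = x₀ := by simp [hH]
  have hH0 : (H.card : ℂ) ≠ 0 := by
    have : (1 : Equiv.Perm X) ∈ H := (hmem 1).mpr ⟨G.one_mem, rfl⟩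
    exact_mod_cast Finset.card_ne_zero_of_mem this
  have hN : (Fintype.card X : ℂ) - 1 ≠ 0 := by
    rw [sub_ne_zero]; exact_mod_cast (by omega : Fintype.card X ≠ 1)
  have hconst : ∀ x, x ≠ x₀ → ∀ y, y ≠ x₀ → ∑ σ ∈ H, b (σ x) = ∑ σ ∈ H, b (σ y) := by
    intro x hx y hy
    obtain ⟨τ, hτ, hτ0, hτx⟩ := hG x₀ x x₀ y hx.symm hy.symm
    refine Finset.sum_bij' (fun σ _ => σ * τ⁻¹) (fun σ _ => σ * τ) ?_ ?_ ?_ ?_ ?_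
    · intro σ hσ
      rw [hmem] at hσ ⊢
      refine ⟨G.mul_mem hσ.1 (G.inv_mem hτ), ?_⟩
      rw [Equiv.Perm.mul_apply, Equiv.Perm.inv_eq_iff_eq.mpr hτ0.symm, hσ.2]
    · intro σ hσ
      rw [hmem] at hσ ⊢
      exact ⟨G.mul_mem hσ.1 hτ, by rw [Equiv.Perm.mul_apply, hτ0, hσ.2]⟩
    · intro σ _; simp
    · intro σ _; simp
    · intro σ _; simp [← hτx]
  have hcard : ((Finset.univ.erase x₀).card : ℂ) = Fintype.card X - 1 := by
    rw [Finset.card_erase_of_mem (Finset.mem_univ _), Finset.card_univ,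
      Nat.cast_sub (by omega), Nat.cast_one]
  have hb' : ∑ y ∈ Finset.univ.erase x₀, b y = -b x₀ := by
    rw [← Finset.add_sum_erase _ _ (Finset.mem_univ x₀)] at hb
    linear_combination hb
  have horb : ∀ x, x ≠ x₀ →
      ((Fintype.card X : ℂ) - 1) * ∑ σ ∈ H, b (σ x) = -(H.card * b x₀) := by
    intro x hx
    calc ((Fintype.card X : ℂ) - 1) * ∑ σ ∈ H, b (σ x)
        = ∑ y ∈ Finset.univ.erase x₀, ∑ σ ∈ H, b (σ y) := by
          rw [Finset.sum_congr rfl fun y hy => hconst y (Finset.ne_of_mem_erase hy) x hx,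
            Finset.sum_const, nsmul_eq_mul, hcard]
      _ = ∑ σ ∈ H, ∑ y ∈ Finset.univ.erase x₀, b (σ y) := Finset.sum_comm
      _ = ∑ σ ∈ H, -b x₀ := by
          refine Finset.sum_congr rfl fun σ hσ => ?_
          have h1 := Finset.add_sum_erase Finset.univ (fun y => b (σ y)) (Finset.mem_univ x₀)
          rw [Equiv.sum_comp σ b, hb] at h1
          simp only [((hmem σ).mp hσ).2] at h1
          linear_combination h1
      _ = -(H.card * b x₀) := by simp
  have hsum : H.card * b x₀ * v x₀ +
      ∑ x ∈ Finset.univ.erase x₀, (∑ σ ∈ H, b (σ x)) * v x = 0 := by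
    calc _ = ∑ x, (∑ σ ∈ H, b (σ x)) * v x := by
          rw [← Finset.add_sum_erase _ _ (Finset.mem_univ x₀)]
          congr 2
          rw [Finset.sum_congr rfl fun σ hσ => by rw [((hmem σ).mp hσ).2]]
          simp
      _ = ∑ σ ∈ H, ∑ x, b (σ x) * v x := by
          simp only [Finset.sum_mul]; exact Finset.sum_comm
      _ = 0 := Finset.sum_eq_zero fun σ hσ => hv σ ((hmem σ).mp hσ).1
  have hmul : ((Fintype.card X : ℂ) - 1) *
      ∑ x ∈ Finset.univ.erase x₀, (∑ σ ∈ H, b (σ x)) * v x =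
        -(H.card * b x₀) * ∑ x ∈ Finset.univ.erase x₀, v x := by
    rw [Finset.mul_sum, Finset.mul_sum]
    refine Finset.sum_congr rfl fun x hx => ?_
    rw [← mul_assoc, horb x (Finset.ne_of_mem_erase hx)]
  have hne : (H.card : ℂ) * b x₀ ≠ 0 := mul_ne_zero hH0 hx₀
  have hfin : ((Fintype.card X : ℂ) - 1) * v x₀ = ∑ x ∈ Finset.univ.erase x₀, v x := by
    refine mul_left_cancel₀ hne ?_
    linear_combination ((Fintype.card X : ℂ) - 1) * hsum - hmul
  rw [← hfin]
  field_simp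

/-- A nonzero polynomial of degree at most `N` with `N` distinct given roots has no other
roots, and these are simple. -/
lemma roots_of_injective {N : ℕ} {P : Polynomial ℂ} (hP : P ≠ 0) (hdeg : P.natDegree ≤ N)
    {z : Fin N → ℂ} (hz : Function.Injective z) (hroot : ∀ i, P.eval (z i) = 0) :
    (∀ w, P.eval w = 0 → ∃ i, z i = w) ∧ ∀ i, P.derivative.eval (z i) ≠ 0 := by
  classical
  have hsub : Finset.univ.image z ⊆ P.roots.toFinset := by
    intro w hw
    obtain ⟨i, -, rfl⟩ := Finset.mem_image.mp hw
    simpa [hP] using hroot i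
  have hcard : (Finset.univ.image z).card = N := by
    rw [Finset.card_image_of_injective _ hz]; simp
  have h1 := P.roots.toFinset_card_le
  have h2 := P.card_roots'
  have h3 := Finset.card_le_card hsub
  constructor
  · intro w hw
    have : w ∈ Finset.univ.image z := by
      rw [Finset.eq_of_subset_of_card_le hsub (by omega)]
      simpa [hP] using hw
    simpa using this
  · intro i hi
    have hnd : P.roots.Nodup := Multiset.toFinset_card_eq_card_iff_nodup.mp (by omega)
    have := Multiset.nodup_iff_count_le_one.mp hnd (z i)
    rw [count_roots] at this
    exact absurd ((one_lt_rootMultiplicity_iff_isRoot hP).mpr ⟨hroot i, hi⟩) (by omega)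

/-!
STATEMENT 8 (the averaging argument in the two-transitive case).

Let `N = deg_z (f + ε g)`, suppose the monodromy group `G` of `f + ε g` is
two-transitive, and suppose `Δ(t,ε) ≡ 0` along a zero cycle `C = ∑ i, a i • z i`
carried by all `N` root branches of `f + ε g = t` (modelled on a polydisc around
a base point `(t₀, ε₀) ∉ Σ`).  If `a i ≠ 0` then, averaging `f` over the orbit
of the cycle under the stabilizer of the fiber `z i`,
`f (z i (t,ε)) = (1/(N-1)) ∑_{j ≠ i} f (z j (t,ε))`; consequently, if
`a i ≠ 0` and `a j ≠ 0` then `f (z i (t,ε)) = f (z j (t,ε))` identically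
(as elements of `ℂ(z₁,…,z_N)`).
-/
open Metric Finset in
theorem two_transitive_averaging
    (f g : Polynomial ℂ) (N : ℕ) (hN : N = defDeg f g) (hN2 : 2 ≤ N)
    (t₀ ε₀ : ℂ) (hbase : ((t₀ : OnePoint ℂ), ε₀) ∉ sigmaSet f g)
    (htrans : IsTwoTransitive (MonodromyGroup f g t₀ ε₀))
    (a : Fin N → ℤ) (hcycle : ∑ i, a i = 0)
    (δ r : ℝ) (hδ : 0 < δ) (hr : 0 < r)
    (z : Fin N → ℂ → ℂ → ℂ)
    (hcont : ∀ i, ContinuousOn (fun p : ℂ × ℂ => z i p.1 p.2)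
      (ball t₀ δ ×ˢ ball ε₀ r))
    (hroot : ∀ i, ∀ t ∈ ball t₀ δ, ∀ ε ∈ ball ε₀ r,
      f.eval (z i t ε) + ε * g.eval (z i t ε) = t)
    (hsep : ∀ i j, i ≠ j → ∀ t ∈ ball t₀ δ, ∀ ε ∈ ball ε₀ r, z i t ε ≠ z j t ε)
    (hvanish : ∀ t ∈ ball t₀ δ, ∀ ε ∈ ball ε₀ r,
      ∑ i, (a i : ℂ) * f.eval (z i t ε) = 0) :
    (∀ i, a i ≠ 0 → ∀ t ∈ ball t₀ δ, ∀ ε ∈ ball ε₀ r,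
      f.eval (z i t ε)
        = (1 / ((N : ℂ) - 1)) * ∑ j ∈ univ.erase i, f.eval (z j t ε)) ∧
    (∀ i j, a i ≠ 0 → a j ≠ 0 → ∀ t ∈ ball t₀ δ, ∀ ε ∈ ball ε₀ r,
      f.eval (z i t ε) = f.eval (z j t ε)) := by
  subst hN
  set U : Set (ℂ × ℂ) := ball t₀ δ ×ˢ ball ε₀ r with hU
  have hUo : IsOpen U := isOpen_ball.prod isOpen_ball
  have hp₀ : (t₀, ε₀) ∈ U := ⟨mem_ball_self hδ, mem_ball_self hr⟩
  let P : ℂ × ℂ → Polynomial ℂ := fun q => f + C q.2 * g - C q.1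
  have hPev (q : ℂ × ℂ) (w : ℂ) : (P q).eval w = 0 ↔ f.eval w + q.2 * g.eval w = q.1 := by
    simp [P, sub_eq_zero]
  have hP0 : ∀ q ∈ U, P q ≠ 0 := by
    rintro ⟨t, ε⟩ ⟨ht, hε⟩ h0
    have hconst (w : ℂ) : f.eval w + ε * g.eval w = t :=
      (hPev (t, ε) w).mp (by rw [h0, eval_zero])
    obtain ⟨t', ht', hne⟩ : ∃ t' ∈ ball t₀ δ, t' ≠ t :=
      (infinite_of_mem_nhds t (isOpen_ball.mem_nhds ht)).nontrivial.exists_ne t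
    exact hne ((hroot ⟨0, by omega⟩ t' ht' ε hε).symm.trans (hconst _))
  have hPdeg (q : ℂ × ℂ) : (P q).natDegree ≤ defDeg f g := by
    refine natDegree_sub_C.trans_le ((natDegree_add_le _ _).trans ?_)
    exact max_le_max le_rfl (natDegree_C_mul_le _ _)
  have hroots (q : ℂ × ℂ) (hq : q ∈ U) := roots_of_injective (hP0 q hq) (hPdeg q)
    (z := fun i => z i q.1 q.2)
    (fun i j hij => by_contra fun h => hsep i j h q.1 hq.1 q.2 hq.2 hij)
    (fun i => (hPev q _).mpr (hroot i q.1 hq.1 q.2 hq.2))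
  have hder (i) (q : ℂ × ℂ) (hq : q ∈ U) :
      f.derivative.eval (z i q.1 q.2) + q.2 * g.derivative.eval (z i q.1 q.2) ≠ 0 := by
    simpa [P] using (hroots q hq).2 i
  have hbranch (i) (q : ℂ × ℂ) (hq : q ∈ U) :
      IsRootBranch f g q (fun q => z i q.1 q.2) :=
    ⟨(hcont i).continuousAt (hUo.mem_nhds hq),
      (hUo.eventually_mem hq).mono fun q hq => hroot i q.1 hq.1 q.2 hq.2⟩
  have hrel_an (b : Fin (defDeg f g) → ℂ) :
      AnalyticOnNhd ℂ (fun q : ℂ × ℂ => ∑ i, b i * f.eval (z i q.1 q.2)) U := fun q hq =>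
    analyticAt_sum_mul_eval f b (φ := fun i q => z i q.1 q.2)
      fun i => (hbranch i q hq).analyticAt (hder i q hq)
  have hUpre : IsPreconnected U :=
    ((convex_ball t₀ δ).prod (convex_ball ε₀ r)).isPreconnected
  let e : Fin (defDeg f g) ≃ theFiber f g t₀ ε₀ := Equiv.ofBijective
    (fun i => ⟨z i t₀ ε₀, hroot i _ hp₀.1 _ hp₀.2⟩)
    ⟨fun i j hij => by_contra fun h =>
        hsep i j h _ hp₀.1 _ hp₀.2 (congrArg Subtype.val hij),
      fun w => ((hroots _ hp₀).1 w.1 ((hPev _ _).mpr w.2)).imp fun i hi => Subtype.ext hi⟩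
  let _ : Fintype (theFiber f g t₀ ε₀) := Fintype.ofEquiv _ e
  have hcardX : Fintype.card (theFiber f g t₀ ε₀) = defDeg f g := by
    rw [← Fintype.card_congr e, Fintype.card_fin]
  let F : theFiber f g t₀ ε₀ → ℂ × ℂ → ℂ := fun x q => z (e.symm x) q.1 q.2
  have hF₀ (x) : F x (t₀, ε₀) = x.1 := congrArg Subtype.val (e.apply_symm_apply x)
  let R : (theFiber f g t₀ ε₀ → ℂ) → Prop := fun b =>
    ∀ᶠ q in nhds (t₀, ε₀), ∑ x, b x * f.eval (F x q) = 0
  have hinv : ∀ σ ∈ MonodromyGroup f g t₀ ε₀, ∀ b, R b ↔ R (b ∘ σ) := by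
    refine Subgroup.iff_comp_of_mem_closure fun σ hσ b => ?_
    have hsum : R b ↔
        ∀ᶠ q in nhds (t₀, ε₀), ∑ x, (b ∘ σ) x * f.eval (F (σ x) q) = 0 :=
      Filter.eventually_congr (.of_forall fun q => by
        rw [← Equiv.sum_comp σ]; rfl)
    rw [hsum]
    exact (hσ.relation_iff (fun x => hbranch _ _ hp₀) hF₀ (b ∘ σ)).symm
  have hsumF (b : Fin (defDeg f g) → ℂ) (G : Fin (defDeg f g) → ℂ) :
      ∑ x, b (e.symm x) * G (e.symm x) = ∑ i, b i * G i :=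
    e.symm.sum_comp fun i => b i * G i
  have hR : R (fun x => (a (e.symm x) : ℂ)) := by
    filter_upwards [hUo.mem_nhds hp₀] with q hq
    exact (hsumF (fun i => a i) fun i => f.eval (z i q.1 q.2)).trans
      (hvanish q.1 hq.1 q.2 hq.2)
  have hRU (b) (hb : R b) (q) (hq : q ∈ U) : ∑ x, b x * f.eval (F x q) = 0 := by
    have hsum (q : ℂ × ℂ) :
        ∑ i, b (e i) * f.eval (z i q.1 q.2) = ∑ x, b x * f.eval (F x q) := by
      rw [← hsumF]; simp [F]
    rw [← hsum]
    refine (hrel_an (b ∘ e)).eqOn_zero_of_preconnected_of_eventuallyEq_zero hUpre hp₀ ?_ hq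
    exact hb.mono fun q hq => (hsum q).trans hq
  have havg : ∀ i, a i ≠ 0 → ∀ t ∈ ball t₀ δ, ∀ ε ∈ ball ε₀ r,
      f.eval (z i t ε)
        = (1 / ((defDeg f g : ℂ) - 1)) * ∑ j ∈ univ.erase i, f.eval (z j t ε) := by
    classical
    intro i hi t ht ε hε
    have h := htrans.eq_average (hcardX ▸ hN2) (b := fun x => (a (e.symm x) : ℂ))
      (v := fun x => f.eval (F x (t, ε))) (x₀ := e i)
      (by rw [e.symm.sum_comp fun i => (a i : ℂ)]; exact_mod_cast hcycle)
      (fun σ hσ => hRU _ ((hinv σ hσ _).mp hR) (t, ε) ⟨ht, hε⟩) (by simpa using hi)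
    rw [hcardX] at h
    simp only [F, Equiv.symm_apply_apply] at h
    rw [h]
    congr 1
    refine Finset.sum_equiv e.symm (fun x => ?_) (fun x _ => rfl)
    simp [Equiv.symm_apply_eq]
  refine ⟨havg, fun i j hi hj t ht ε hε => ?_⟩
  have hN1 : (defDeg f g : ℂ) - 1 ≠ 0 := by
    rw [sub_ne_zero]; exact_mod_cast (by omega : defDeg f g ≠ 1)
  have hN0 : (defDeg f g : ℂ) ≠ 0 := by exact_mod_cast (by omega : defDeg f g ≠ 0)
  have htotal (k) (hk : a k ≠ 0) :
      (defDeg f g : ℂ) * f.eval (z k t ε) = ∑ j, f.eval (z j t ε) := by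
    have h := havg k hk t ht ε hε
    rw [one_div, eq_inv_mul_iff_mul_eq₀ hN1] at h
    rw [← Finset.add_sum_erase _ _ (Finset.mem_univ k), ← h]
    ring
  exact mul_left_cancel₀ hN0 ((htotal i hi).trans (htotal j hj).symm)

end
end

section
/- Let f(z) = z^6, g(z) = z^3 + z^2, and let C(t) = Σ_{j=0}^{5} n_j z_j(t) with z_j(t) = t^{1/6} e^{2πij/6} and (n_0,…,n_5) = (2,1,−1,−2,−1,1). Then the first Melnikov function vanishes identically: M_1(t) = Σ_{j=0}^5 n_j g(z_j(t)) ≡ 0 for all regular t; indeed the projections of C by both h_1(z) = z^3 and h_2(z) = z^2 are trivial cycles. -/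
/-!
STATEMENT 12 (Example: the tangential problem for `f(z) = z⁶`).

Let `f(z) = z⁶`, `g(z) = z³ + z²`, and let `C(t) = ∑_{j=0}^{5} n_j z_j(t)` with
`z_j(t) = t^{1/6} e^{2πij/6}` and `(n₀,…,n₅) = (2,1,−1,−2,−1,1)`.  We parametrize
the regular values `t ≠ 0` as `t = w⁶` with `w ≠ 0`, so that `z_j(t) = w ζ^j`
with `ζ = e^{2πi/6}`.  Then the first Melnikov function vanishes identically:
`M₁(t) = ∑_j n_j g(z_j(t)) ≡ 0`; indeed the projections of `C` by both
`h₁(z) = z³` and `h₂(z) = z²` are trivial cycles.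
-/

open Finset

theorem IsPrimitiveRoot.mul_pow_pow_eq_iff {K : Type*} [Field K] {ζ w : K} {m : ℕ}
    (h : IsPrimitiveRoot ζ m) (hm : m ≠ 0) (hw : w ≠ 0) (k i j : ℕ) :
    (w * ζ ^ j) ^ k = (w * ζ ^ i) ^ k ↔ j * k % m = i * k % m := by
  rw [mul_pow, mul_pow, mul_right_inj' (pow_ne_zero k hw), ← pow_mul, ← pow_mul,
    ← pow_mod_orderOf ζ (j * k), ← pow_mod_orderOf ζ (i * k), ← h.eq_orderOf]
  have hpos := Nat.pos_of_ne_zero hm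
  exact ⟨h.pow_inj (Nat.mod_lt _ hpos) (Nat.mod_lt _ hpos), fun e => by rw [e]⟩

theorem example_z6_tangential_center
    (ζ : ℂ) (hζ : ζ = Complex.exp (2 * Real.pi * Complex.I / 6))
    (n : Fin 6 → ℤ) (hn : n = ![2, 1, -1, -2, -1, 1]) :
    ∀ w : ℂ, w ≠ 0 →
      -- M₁ ≡ 0 : the zero-dimensional abelian integral of g = z³ + z² along C
      (∑ j : Fin 6, (n j : ℂ) *
          ((w * ζ ^ (j : ℕ)) ^ 3 + (w * ζ ^ (j : ℕ)) ^ 2) = 0) ∧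
      -- the projection of C by h₁(z) = z³ is a trivial cycle
      (∀ i : Fin 6, ∑ j ∈ univ.filter
          (fun j : Fin 6 => (w * ζ ^ (j : ℕ)) ^ 3 = (w * ζ ^ (i : ℕ)) ^ 3), n j = 0) ∧
      -- the projection of C by h₂(z) = z² is a trivial cycle
      (∀ i : Fin 6, ∑ j ∈ univ.filter
          (fun j : Fin 6 => (w * ζ ^ (j : ℕ)) ^ 2 = (w * ζ ^ (i : ℕ)) ^ 2), n j = 0) := by
  intro w hw
  have hprim : IsPrimitiveRoot ζ 6 := by
    rw [hζ]
    exact_mod_cast Complex.isPrimitiveRoot_exp 6 (by norm_num)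
  subst hn
  refine ⟨?_, ?_, ?_⟩
  · have h6 := hprim.pow_eq_one
    simp only [Fin.sum_univ_succ, Fin.sum_univ_zero]
    simp [Fin.succ]
    linear_combination
      (w ^ 3 * (ζ ^ 9 - ζ ^ 6 - ζ ^ 3 - 2) + w ^ 2 * (ζ ^ 4 - ζ ^ 2 - 2)) * h6
  · simp only [hprim.mul_pow_pow_eq_iff (by norm_num) hw]
    decide
  · simp only [hprim.mul_pow_pow_eq_iff (by norm_num) hw]
    decide
end

section
/- Let f(z) = z^4, g(z) = a z^4 + b z^2 + c with a, b, c ∈ ℂ, and let C(t) = Σ_{j=0}^{3} n_j z_j(t) be a zero cycle of f with z_j(1) = i^j. The roots of f(z) + εg(z) = t are z_j(t,ε) = (−1)^{⌊j/2⌋} √((−εb + (−1)^j √(ε²b² − 4(εc − t)(1 + εa)))/(2(1+εa))), and the displacement function is Δ(t,ε) = εb(−n_0 + n_1 − n_2 + n_3)√(ε²b² − 4(εc − t)(1 + εa)) / (2(1+εa)²). Hence Δ ≡ 0 for all t, ε if and only if b = 0 or n_1 + n_3 = n_0 + n_2; in the first case g = a f + c, and in the second case, with h(z) = z², f = h²,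 g = a h² + b h + c and the projection of C_ε by h is trivial (n_0 + n_2 = 0 and n_1 + n_3 = 0). -/
/-!
STATEMENT 14 (Example: a simple monomial perturbation).

Let `f(z) = z⁴`, `g(z) = a z⁴ + b z² + c`, and let `C(t) = ∑_{j=0}^{3} n_j z_j(t)`
be a zero cycle of `f` with `z_j(1) = i^j`.  The roots of `f + ε g = t` are
`z_j(t,ε) = (−1)^{⌊j/2⌋} √((−εb + (−1)^j √(ε²b² − 4(εc − t)(1 + εa)))/(2(1+εa)))`
(the square roots are modelled by functions `r` and `s` whose squares are the
corresponding radicands), and the displacement function is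
`Δ(t,ε) = εb(−n₀+n₁−n₂+n₃)√(ε²b² − 4(εc − t)(1+εa)) / (2(1+εa)²)`.
Hence `Δ ≡ 0` iff `b = 0` or `n₁ + n₃ = n₀ + n₂`; in the first case
`g = a f + c`, and in the second, with `h(z) = z²`, `f = h²`,
`g = a h² + b h + c` and the projection of `C_ε` by `h` is trivial
(`n₀ + n₂ = 0` and `n₁ + n₃ = 0`).
-/

theorem example_z4_monomial_perturbation
    (a b c : ℂ) (n : Fin 4 → ℤ) (hcycle : ∑ j, n j = 0)
    -- the inner square root: r(t,ε)² = ε²b² − 4(εc − t)(1 + εa)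
    (r : ℂ → ℂ → ℂ)
    (hr : ∀ t ε : ℂ, (r t ε) ^ 2 = ε ^ 2 * b ^ 2 - 4 * (ε * c - t) * (1 + ε * a))
    -- the outer square roots
    (s : Fin 4 → ℂ → ℂ → ℂ)
    (hs : ∀ (j : Fin 4) (t ε : ℂ), 1 + ε * a ≠ 0 →
      (s j t ε) ^ 2 = (-(ε * b) + (-1 : ℂ) ^ (j : ℕ) * r t ε) / (2 * (1 + ε * a)))
    -- the roots z_j(t,ε) = (−1)^⌊j/2⌋ s_j(t,ε)
    (z : Fin 4 → ℂ → ℂ → ℂ)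
    (hz : ∀ (j : Fin 4) (t ε : ℂ), z j t ε = (-1 : ℂ) ^ ((j : ℕ) / 2) * s j t ε)
    -- the cycle is pinned by z_j(1,0) = i^j
    (hinit : ∀ j : Fin 4, z j 1 0 = Complex.I ^ (j : ℕ)) :
    -- z_j(t,ε) are indeed roots of f + εg = t
    (∀ (j : Fin 4) (t ε : ℂ), 1 + ε * a ≠ 0 →
      (z j t ε) ^ 4 + ε * (a * (z j t ε) ^ 4 + b * (z j t ε) ^ 2 + c) = t) ∧
    -- the closed formula for the displacement function Δ(t,ε) = ∑ n_j f(z_j(t,ε))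
    (∀ (t ε : ℂ), 1 + ε * a ≠ 0 →
      ∑ j : Fin 4, (n j : ℂ) * (z j t ε) ^ 4
        = ε * b * (-(n 0 : ℂ) + (n 1 : ℂ) - (n 2 : ℂ) + (n 3 : ℂ)) * r t ε
            / (2 * (1 + ε * a) ^ 2)) ∧
    -- Δ ≡ 0 iff b = 0 or n₁ + n₃ = n₀ + n₂
    ((∀ (t ε : ℂ), 1 + ε * a ≠ 0 →
        ∑ j : Fin 4, (n j : ℂ) * (z j t ε) ^ 4 = 0)
      ↔ (b = 0 ∨ n 1 + n 3 = n 0 + n 2)) ∧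
    -- first case: g = a f + c
    (b = 0 → ∀ w : ℂ, a * w ^ 4 + b * w ^ 2 + c = a * w ^ 4 + c) ∧
    -- second case: the projection of the cycle by h(z) = z² is trivial
    (n 1 + n 3 = n 0 + n 2 → n 0 + n 2 = 0 ∧ n 1 + n 3 = 0) := by
  have hz2 : ∀ (j : Fin 4) (t ε : ℂ), 1 + ε * a ≠ 0 →
      (z j t ε) ^ 2 = (-(ε * b) + (-1 : ℂ) ^ (j : ℕ) * r t ε) / (2 * (1 + ε * a)) := by
    intro j t ε hD
    rw [hz, mul_pow, hs j t ε hD, ← pow_mul, mul_comm _ 2, pow_mul]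
    norm_num
  have hz4 : ∀ (j : Fin 4) (t ε : ℂ), (z j t ε) ^ 4 = ((z j t ε) ^ 2) ^ 2 := by
    intro j t ε
    ring
  have hroot : ∀ (j : Fin 4) (t ε : ℂ), 1 + ε * a ≠ 0 →
      (z j t ε) ^ 4 + ε * (a * (z j t ε) ^ 4 + b * (z j t ε) ^ 2 + c) = t := by
    intro j t ε hD
    have hsq : ((-1 : ℂ) ^ (j : ℕ)) ^ 2 = 1 := by
      rw [← pow_mul, mul_comm, pow_mul]
      norm_num
    have hw : 2 * (1 + ε * a) * (z j t ε) ^ 2 + ε * b = (-1 : ℂ) ^ (j : ℕ) * r t ε := by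
      rw [hz2 j t ε hD]
      field_simp
      ring
    have hw2 : (2 * (1 + ε * a) * (z j t ε) ^ 2 + ε * b) ^ 2
        = ε ^ 2 * b ^ 2 - 4 * (ε * c - t) * (1 + ε * a) := by
      rw [hw, mul_pow, hsq, one_mul, hr]
    have h4D : 4 * (1 + ε * a) ≠ 0 := mul_ne_zero (by norm_num) hD
    apply mul_left_cancel₀ h4D
    linear_combination hw2
  have hsum : (n 0 : ℂ) + n 1 + n 2 + n 3 = 0 := by
    rw [Fin.sum_univ_four] at hcycle
    exact_mod_cast hcycle
  have hdisp : ∀ (t ε : ℂ), 1 + ε * a ≠ 0 →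
      ∑ j : Fin 4, (n j : ℂ) * (z j t ε) ^ 4
        = ε * b * (-(n 0 : ℂ) + (n 1 : ℂ) - (n 2 : ℂ) + (n 3 : ℂ)) * r t ε
            / (2 * (1 + ε * a) ^ 2) := by
    intro t ε hD
    have hn : (n 3 : ℂ) = -(n 0 : ℂ) - n 1 - n 2 := by linear_combination hsum
    simp only [Fin.sum_univ_four, hz4, hz2 _ t ε hD, hn, Fin.val_zero, Fin.val_one, Fin.val_two,
      show ((3 : Fin 4) : ℕ) = 3 from rfl]
    field_simp
    ring
  refine ⟨hroot, hdisp, ⟨fun h => ?_, ?_⟩, ?_, ?_⟩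
  · rw [or_iff_not_imp_left]
    intro hb
    obtain ⟨ε, hε, hD⟩ : ∃ ε : ℂ, ε ≠ 0 ∧ 1 + ε * a ≠ 0 := by
      by_cases ha : 1 + 1 * a = 0
      · refine ⟨-1, by norm_num, fun h' => ?_⟩
        have h2 : (2 : ℂ) = 0 := by linear_combination ha + h'
        norm_num at h2
      · exact ⟨1, one_ne_zero, ha⟩
    -- at `t = εc` the inner radicand is `(εb)² ≠ 0`
    have hr0 : r (ε * c) ε ≠ 0 := by
      intro h0
      have hrad := hr (ε * c) ε
      rw [h0] at hrad
      apply pow_ne_zero 2 (mul_ne_zero hε hb)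
      linear_combination -hrad
    have h0 := h (ε * c) ε hD
    rw [hdisp _ _ hD] at h0
    have hn : -(n 0 : ℂ) + n 1 - n 2 + n 3 = 0 := by
      simpa [hε, hb, hr0, hD] using h0
    have hn' : -(n 0) + n 1 - n 2 + n 3 = 0 := by exact_mod_cast hn
    omega
  · rintro (hb | hn) t ε hD
    · rw [hdisp t ε hD, hb]
      simp
    · have hn' : (n 1 : ℂ) + n 3 = n 0 + n 2 := by exact_mod_cast hn
      have h0 : -(n 0 : ℂ) + n 1 - n 2 + n 3 = 0 := by linear_combination hn'
      rw [hdisp t ε hD, h0]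
      simp
  · intro hb w
    rw [hb]
    ring
  · intro h
    rw [Fin.sum_univ_four] at hcycle
    omega
end
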